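/- arXiv:math/9801072 — 2 statements merged into one kernel-verified Lean document; each statement's English description precedes it below -/
import Mathlib

section
/- For every z in the upper half-plane, (d/dz) j_2(z) = −2πi · E_{γ,2}(z) · E_{0,4}(z) · E_{∞,4}(z)^{−1}. -/
open Complex Filter UpperHalfPlane
open scoped MatrixGroups ModularForm Manifold

noncomputable section

/-- `q = e^{2πiz}`. -/
def qexp (z : ℂ) : ℂ := Complex.exp (2 * Real.pi * Complex.I * z)

/-- `σ^odd(n) = Σ_{d∣n, d odd} d`. -/
def sigmaOdd (n : ℕ) : ℕ := ∑ d ∈ n.divisors.filter (fun d => Odd d), d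

/-- `σ₃^alt(n) = Σ_{d∣n} (-1)^d d³`. -/
def sigma3Alt (n : ℕ) : ℤ := ∑ d ∈ n.divisors, (-1 : ℤ) ^ d * (d : ℤ) ^ 3

/-- `σ*_{2,3}(n) = Σ_{d∣n, n/d odd} d³`. -/
def sigmaStar3 (n : ℕ) : ℕ := ∑ d ∈ n.divisors.filter (fun d => Odd (n / d)), d ^ 3

/-- `E_{γ,2} = 1 + 24 Σ σ^odd(n) qⁿ`. -/
def Egamma2 (z : ℂ) : ℂ := 1 + 24 * ∑' n : ℕ+, (sigmaOdd n : ℂ) * qexp z ^ (n : ℕ)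

/-- `E_{0,4} = 1 + 16 Σ σ₃^alt(n) qⁿ`. -/
def E04 (z : ℂ) : ℂ := 1 + 16 * ∑' n : ℕ+, (sigma3Alt n : ℂ) * qexp z ^ (n : ℕ)

/-- `E_{∞,4} = Σ σ*_{2,3}(n) qⁿ`. -/
def Einf4 (z : ℂ) : ℂ := ∑' n : ℕ+, (sigmaStar3 n : ℂ) * qexp z ^ (n : ℕ)

/-- `j₂ = E_{γ,2}² / E_{∞,4}`. -/
def j2 (z : ℂ) : ℂ := Egamma2 z ^ 2 / Einf4 z

section SerreDerivative

open Topology ModularForm EisensteinSeries Derivative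

/-- A `q`-series tends to its constant coefficient at `i∞`. -/
lemma tendsto_atImInfty_of_hasSum {f : ℍ → ℂ} {c : ℕ → ℂ}
    (hf : ∀ τ : ℍ, HasSum (fun m ↦ c m • Function.Periodic.qParam 1 τ ^ m) (f τ)) :
    Tendsto f atImInfty (𝓝 (c 0)) := by
  have hlim : ∑' m : ℕ, (if m = 0 then c 0 else 0) = c 0 := tsum_ite_eq 0 _
  rw [← hlim, funext fun τ ↦ (hf τ).tsum_eq.symm]
  refine tendsto_tsum_of_dominated_convergence (hf UpperHalfPlane.I).summable.norm (fun m ↦ ?_) ?_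
  · have hq := qParam_tendsto_atImInfty one_pos
    rcases eq_or_ne m 0 with rfl | hm
    · simp
    · simpa [hm] using (hq.pow m).const_mul (c m)
  · filter_upwards [tendsto_coe_atImInfty.eventually
      (preimage_mem_comap (Ici_mem_atTop (1 : ℝ)))] with τ hτ m
    have hτ1 : 1 ≤ τ.im := hτ
    rw [norm_smul, norm_smul, norm_pow, norm_pow]
    gcongr
    rw [Function.Periodic.norm_qParam, Function.Periodic.norm_qParam, Real.exp_le_exp]
    have := Real.pi_pos
    simp only [UpperHalfPlane.coe_im, UpperHalfPlane.I_im, div_one]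
    nlinarith

lemma tendsto_E2_atImInfty : Tendsto E2 atImInfty (𝓝 1) := by
  have h := tendsto_atImInfty_of_hasSum (f := E2) fun τ ↦ by
    simpa only [Function.Periodic.qParam, ofReal_one, div_one] using hasSum_qExpansion_E2 (z := τ)
  rwa [if_pos rfl] at h

lemma tendsto_E_atImInfty {k : ℕ} (hk : 3 ≤ k) (hk2 : Even k) :
    Tendsto (E hk) atImInfty (𝓝 1) := by
  rw [← E_qExpansion_coeff_zero hk hk2]
  exact tendsto_atImInfty_of_hasSum fun τ ↦
    ModularForm.hasSum_qExpansion (E hk) one_pos one_mem_strictPeriods_SL τ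

/-- The normalized derivative of a level one modular form vanishes at `i∞`. -/
lemma tendsto_normalizedDeriv_atImInfty {k : ℤ} (f : ModularForm 𝒮ℒ k) :
    Tendsto (normalizedDerivOfComplex f) atImInfty (𝓝 0) := by
  have hq := qParam_tendsto_atImInfty one_pos
  have han : AnalyticAt ℂ (cuspFunction 1 f) 0 :=
    ModularFormClass.analyticAt_cuspFunction_zero f one_pos one_mem_strictPeriods_SL
  have hD (τ : ℍ) : normalizedDerivOfComplex f τ =
      Function.Periodic.qParam 1 τ * deriv (cuspFunction 1 f) (Function.Periodic.qParam 1 τ) := by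
    have hg : DifferentiableAt ℂ (cuspFunction 1 f) (Function.Periodic.qParam 1 τ) :=
      ModularFormClass.differentiableAt_cuspFunction f one_pos one_mem_strictPeriods_SL
        (Function.Periodic.norm_qParam_lt_one one_pos τ.im_pos)
    have hqd : HasDerivAt (fun w : ℂ ↦ Function.Periodic.qParam 1 w)
        (Function.Periodic.qParam 1 τ * (2 * Real.pi * Complex.I)) τ := by
      have := ((hasDerivAt_id (τ : ℂ)).const_mul (2 * Real.pi * Complex.I)).cexp
      simpa [Function.Periodic.qParam] using this
    have heq : (f ∘ ofComplex) =ᶠ[𝓝 (τ : ℂ)]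
        (cuspFunction 1 f) ∘ fun w : ℂ ↦ Function.Periodic.qParam 1 w := by
      filter_upwards [isOpen_upperHalfPlaneSet.mem_nhds τ.im_pos] with w hw
      have := SlashInvariantFormClass.eq_cuspFunction f (⟨w, hw⟩ : ℍ)
        one_mem_strictPeriods_SL one_ne_zero
      simp only [Function.comp_apply, ofComplex_apply_of_im_pos hw]
      exact this.symm
    rw [normalizedDerivOfComplex, heq.deriv_eq, (hg.hasDerivAt.comp _ hqd).deriv]
    have := Real.pi_ne_zero
    field_simp
  rw [funext hD]
  simpa using hq.mul (han.deriv.continuousAt.tendsto.comp hq)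

lemma tendsto_serreDerivative_atImInfty {k : ℤ} (f : ModularForm 𝒮ℒ k)
    {a : ℂ} (ha : Tendsto f atImInfty (𝓝 a)) :
    Tendsto (serreDerivative k f) atImInfty (𝓝 (-(k * 12⁻¹ * a))) := by
  simpa using (tendsto_normalizedDeriv_atImInfty f).sub
    ((tendsto_E2_atImInfty.const_mul ((k : ℂ) * 12⁻¹)).mul ha)

/-- The Serre derivative of a level one modular form, as a modular form. -/
def serreDerivativeForm {k : ℤ} (f : ModularForm 𝒮ℒ k) {a : ℂ}
    (ha : Tendsto f atImInfty (𝓝 a)) : ModularForm 𝒮ℒ (k + 2) where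
  toFun := serreDerivative k f
  slash_action_eq' := fun _ ⟨γ, hγ⟩ ↦ hγ ▸
    serreDerivative_slash_invariant f.holo' (f.slash_action_eq' _ ⟨γ, rfl⟩)
  holo' := serreDerivative_mdifferentiable _ f.holo'
  bdd_at_cusps' {c} hc := by
    rw [Subgroup.IsArithmetic.isCusp_iff_isCusp_SL2Z] at hc
    rw [OnePoint.isBoundedAt_iff_forall_SL2Z hc]
    intro γ _
    rw [serreDerivative_slash_invariant (F := f) f.holo' (f.slash_action_eq' _ ⟨γ, rfl⟩)]
    exact (tendsto_serreDerivative_atImInfty f ha).isBigO_one ℝ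

/-- In a one-dimensional space of level one forms, a form is determined by its limit at `i∞`. -/
lemma eq_mul_of_rank_one {k : ℤ} (h1 : Module.rank ℂ (ModularForm 𝒮ℒ k) = 1)
    (f g : ModularForm 𝒮ℒ k) {a : ℂ} (hf : Tendsto f atImInfty (𝓝 a))
    (hg : Tendsto g atImInfty (𝓝 1)) (z : ℍ) : f z = a * g z := by
  have hg0 : g ≠ 0 := by
    rintro rfl
    exact zero_ne_one (tendsto_nhds_unique (tendsto_const_nhds (x := (0 : ℂ))) hg)
  obtain ⟨c, hc⟩ := (finrank_eq_one_iff_of_nonzero' g hg0).mp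
    (Module.rank_eq_one_iff_finrank_eq_one.mp h1) f
  have hfg (τ : ℍ) : f τ = c * g τ := by rw [← hc]; rfl
  have hca : a = c := tendsto_nhds_unique hf (by simpa [funext hfg] using hg.const_mul c)
  rw [hfg, hca]

/-- Ramanujan's formula for the derivative of `E₄`. -/
lemma normalizedDeriv_E₄ (z : ℍ) :
    normalizedDerivOfComplex E₄ z = (E2 z * E₄ z - E₆ z) / 3 := by
  have h4 := tendsto_E_atImInfty (k := 4) (by norm_num) ⟨2, rfl⟩
  have h6 := tendsto_E_atImInfty (k := 6) (by norm_num) ⟨3, rfl⟩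
  have h := eq_mul_of_rank_one levelOne_weight_six_rank_one (serreDerivativeForm E₄ h4) E₆
    (tendsto_serreDerivative_atImInfty E₄ h4) h6 z
  have h' : serreDerivative (4 : ℤ) E₄ z = -((4 : ℤ) * 12⁻¹ * 1) * E₆ z := h
  rw [serreDerivative_apply] at h'
  push_cast at h'
  linear_combination h'

/-- Ramanujan's formula for the derivative of `E₆`. -/
lemma normalizedDeriv_E₆ (z : ℍ) :
    normalizedDerivOfComplex E₆ z = (E2 z * E₆ z - E₄ z ^ 2) / 2 := by
  have h4 := tendsto_E_atImInfty (k := 4) (by norm_num) ⟨2, rfl⟩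
  have h6 := tendsto_E_atImInfty (k := 6) (by norm_num) ⟨3, rfl⟩
  have h8 : Module.rank ℂ (ModularForm 𝒮ℒ 8) = 1 := by
    have := dimension_level_one 8 ⟨4, rfl⟩
    norm_num [Nat.ModEq] at this
    exact this
  have h := eq_mul_of_rank_one h8 (serreDerivativeForm E₆ h6) (E₄.mul E₄)
    (tendsto_serreDerivative_atImInfty E₆ h6) (by simpa using! h4.mul h4) z
  have h' : serreDerivative (6 : ℤ) E₆ z = -((6 : ℤ) * 12⁻¹ * 1) * (E₄ z * E₄ z) := h
  rw [serreDerivative_apply] at h'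
  push_cast at h'
  linear_combination h'

end SerreDerivative

section QSeries

open Topology

lemma sum_even_divisors_eq (n : ℕ) :
    ∑ d ∈ n.divisors.filter (fun d ↦ Even d), d ^ 3 =
      8 * ∑ d ∈ n.divisors.filter (fun d ↦ Even (n / d)), d ^ 3 := by
  rw [Finset.mul_sum]
  refine Finset.sum_nbij' (fun d ↦ d / 2) (fun d ↦ 2 * d) ?_ ?_ ?_ ?_ ?_
  · simp only [Finset.mem_filter, Nat.mem_divisors]
    rintro d ⟨⟨⟨c, rfl⟩, hn⟩, ⟨e, rfl⟩⟩
    have he : 0 < e := by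
      rcases Nat.eq_zero_or_pos e with rfl | h
      · simp at hn
      · exact h
    have h2 : (e + e) / 2 = e := by lia
    rw [h2, show (e + e) * c = e * (2 * c) by ring, Nat.mul_div_cancel_left _ he]
    exact ⟨⟨⟨_, rfl⟩, by rintro h; apply hn; linarith⟩, even_two_mul c⟩
  · simp only [Finset.mem_filter, Nat.mem_divisors]
    rintro d ⟨⟨⟨c, rfl⟩, hn⟩, hc⟩
    have hd : 0 < d := Nat.pos_of_ne_zero (by rintro rfl; simp at hn)
    rw [Nat.mul_div_cancel_left _ hd] at hc
    obtain ⟨e, rfl⟩ := hc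
    exact ⟨⟨⟨e, by ring⟩, hn⟩, even_two_mul d⟩
  · simp only [Finset.mem_filter]
    rintro d ⟨-, hd⟩
    exact Nat.two_mul_div_two_of_even hd
  · intro d _
    simp
  · simp only [Finset.mem_filter]
    rintro d ⟨-, ⟨e, rfl⟩⟩
    have h2 : (e + e) / 2 = e := by lia
    rw [h2]
    ring

lemma fifteen_mul_sigma_three (n : ℕ) :
    15 * (ArithmeticFunction.sigma 3 n : ℤ) = sigma3Alt n + 16 * sigmaStar3 n := by
  have h1 : ∀ d : ℕ, (-1 : ℤ) ^ d * (d : ℤ) ^ 3 =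
      2 * (if Even d then (d : ℤ) ^ 3 else 0) - (d : ℤ) ^ 3 := by
    intro d
    rcases Nat.even_or_odd d with h | h
    · simp [h, h.neg_one_pow]; ring
    · simp [h.neg_one_pow, Nat.not_even_iff_odd.mpr h]
  have h2 := sum_even_divisors_eq n
  have h3 := Finset.sum_filter_add_sum_filter_not n.divisors (fun d ↦ Even (n / d))
    (fun d ↦ d ^ 3)
  simp only [Nat.not_even_iff_odd] at h3
  rw [sigma3Alt, sigmaStar3, ArithmeticFunction.sigma_apply, Finset.sum_congr rfl fun d _ ↦ h1 d,
    Finset.sum_sub_distrib, ← Finset.mul_sum, ← Finset.sum_filter]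
  zify at h2 h3
  push_cast
  linarith

lemma norm_sum_divisors_le {n k : ℕ} {g : ℕ → ℂ} (hg : ∀ d, ‖g d‖ ≤ (d : ℝ) ^ k) :
    ‖∑ d ∈ n.divisors, g d‖ ≤ (n : ℝ) ^ (k + 1) := by
  calc ‖∑ d ∈ n.divisors, g d‖ ≤ ∑ _d ∈ n.divisors, (n : ℝ) ^ k := by
        refine norm_sum_le_of_le _ fun d hd ↦ (hg d).trans ?_
        gcongr
        exact Nat.divisor_le hd
    _ = n.divisors.card * (n : ℝ) ^ k := by simp
    _ ≤ n * (n : ℝ) ^ k := by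
        gcongr
        exact Nat.card_divisors_le_self n
    _ = (n : ℝ) ^ (k + 1) := by ring

lemma norm_sigmaOdd_le (n : ℕ) : ‖(sigmaOdd n : ℂ)‖ ≤ (n : ℝ) ^ 2 := by
  rw [sigmaOdd, Finset.sum_filter, Nat.cast_sum]
  refine norm_sum_divisors_le fun d ↦ ?_
  split_ifs <;> simp

lemma norm_sigma3Alt_le (n : ℕ) : ‖(sigma3Alt n : ℂ)‖ ≤ (n : ℝ) ^ 4 := by
  rw [sigma3Alt, Int.cast_sum]
  refine norm_sum_divisors_le fun d ↦ ?_
  simp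

lemma norm_sigmaStar3_le (n : ℕ) : ‖(sigmaStar3 n : ℂ)‖ ≤ (n : ℝ) ^ 4 := by
  rw [sigmaStar3, Finset.sum_filter, Nat.cast_sum]
  refine norm_sum_divisors_le fun d ↦ ?_
  split_ifs <;> simp

lemma norm_qexp_lt_one {z : ℂ} (hz : 0 < z.im) : ‖qexp z‖ < 1 :=
  UpperHalfPlane.norm_exp_two_pi_I_lt_one ⟨z, hz⟩

lemma summable_qSeries {a : ℕ → ℂ} {k : ℕ} (ha : ∀ n, ‖a n‖ ≤ (n : ℝ) ^ k) {r : ℂ}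
    (hr : ‖r‖ < 1) : Summable fun n : ℕ+ ↦ a n * r ^ (n : ℕ) := by
  have h : Summable fun n : ℕ ↦ a n * r ^ n := by
    refine .of_norm_bounded (summable_norm_pow_mul_geometric_of_norm_lt_one k hr) fun n ↦ ?_
    rw [norm_mul, norm_mul, norm_pow (n : ℂ), norm_natCast]
    gcongr
    exact ha n
  exact h.subtype _

lemma differentiableAt_qSeries {a : ℕ → ℂ} {k : ℕ} (ha : ∀ n, ‖a n‖ ≤ (n : ℝ) ^ k) {z : ℂ}
    (hz : 0 < z.im) :
    DifferentiableAt ℂ (fun w ↦ ∑' n : ℕ+, a n * qexp w ^ (n : ℕ)) z := by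
  have hd : Differentiable ℂ qexp := by
    unfold qexp
    fun_prop
  obtain ⟨ρ, hρ1, hρ2⟩ := exists_between (norm_qexp_lt_one hz)
  have hρ0 : 0 ≤ ρ := (norm_nonneg _).trans hρ1.le
  have hopen : IsOpen {w : ℂ | ‖qexp w‖ < ρ} :=
    isOpen_lt hd.continuous.norm continuous_const
  have hsum : Summable fun n : ℕ+ ↦ (n : ℝ) ^ k * ρ ^ (n : ℕ) :=
    (summable_pow_mul_geometric_of_norm_lt_one k
      (by rwa [Real.norm_of_nonneg hρ0] : ‖ρ‖ < 1)).subtype _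
  refine (differentiableOn_tsum_of_summable_norm hsum (fun n ↦ ?_) hopen
    fun n w hw ↦ ?_).differentiableAt (hopen.mem_nhds hρ1)
  · exact ((hd.pow _).const_mul _).differentiableOn
  · rw [norm_mul, norm_pow]
    have hw' : ‖qexp w‖ ≤ ρ := le_of_lt hw
    gcongr
    exact ha n

lemma tsum_tsum_mul_pow {g : ℕ → ℂ} {k : ℕ} (hg : ∀ d, ‖g d‖ ≤ (d : ℝ) ^ k) {r : ℂ}
    (hr : ‖r‖ < 1) :
    ∑' n : ℕ+, ∑' d : ℕ+, g d * r ^ (n * d : ℕ) =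
      ∑' n : ℕ+, (∑ d ∈ (n : ℕ).divisors, g d) * r ^ (n : ℕ) := by
  have hs : Summable fun c : ℕ+ × ℕ+ ↦ g c.2 * r ^ (c.1 * c.2 : ℕ) := by
    refine .of_norm_bounded (summable_prod_mul_pow k hr).norm fun c ↦ ?_
    rw [norm_mul, norm_mul, norm_pow (c.2 : ℂ), norm_natCast]
    gcongr
    exact hg _
  rw [← hs.tsum_prod, ← sigmaAntidiagonalEquivProd.tsum_eq]
  have hs' := (sigmaAntidiagonalEquivProd.summable_iff).mpr hs
  rw [Summable.tsum_sigma (by simpa only [Function.comp_def] using hs')]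
  refine tsum_congr fun n ↦ ?_
  simpa [sigmaAntidiagonalEquivProd, divisorsAntidiagonalFactors, tsum_fintype, Finset.sum_mul,
    (n : ℕ).divisorsAntidiagonal.sum_attach fun x : ℕ × ℕ ↦ g x.2 * r ^ (x.1 * x.2),
    Nat.sum_divisorsAntidiagonal' fun x y ↦ g y * r ^ (x * y)]
      using Finset.sum_congr rfl fun i hi ↦ by
        rw [Nat.div_mul_cancel (Nat.dvd_of_mem_divisors hi)]

end QSeries

section WeierstrassHalfPeriod

open Topology

variable (L : PeriodPair)

lemma PeriodPair.lattice_countable : (L.lattice : Set ℂ).Countable :=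
  Set.countable_coe_iff.mp L.latticeEquivProd.toEquiv.injective.countable

lemma PeriodPair.isConnected_compl_lattice : IsConnected (L.lattice : Set ℂ)ᶜ :=
  L.lattice_countable.isConnected_compl_of_one_lt_rank (by simp)

lemma PeriodPair.not_eventually_derivWeierstrassP_eq_zero {x : ℂ} (hx : x ∉ L.lattice) :
    ¬ ∀ᶠ w in 𝓝 x, L.derivWeierstrassP w = 0 := by
  intro h
  have h0 := L.analyticOnNhd_derivWeierstrassP.eqOn_zero_of_preconnected_of_eventuallyEq_zero
    L.isConnected_compl_lattice.isPreconnected hx h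
  obtain ⟨a, ha⟩ := L.isClosed_lattice.isOpen_compl.exists_is_const_of_deriv_eq_zero
    L.isConnected_compl_lattice.isPreconnected L.differentiableOn_weierstrassP
    (by rwa [L.deriv_weierstrassP])
  have hev : L.weierstrassP =ᶠ[𝓝[≠] 0] fun _ ↦ a := by
    filter_upwards [nhdsWithin_le_nhds (L.compl_lattice_sdiff_singleton_mem_nhds 0),
      self_mem_nhdsWithin] with w hw hw0
    exact ha w fun hl ↦ hw ⟨hl, hw0⟩
  have h2 := L.order_weierstrassP 0 L.lattice.zero_mem
  rw [meromorphicOrderAt_congr hev] at h2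
  have h3 := (analyticAt_const (𝕜 := ℂ) (v := a) (x := (0 : ℂ))).meromorphicOrderAt_nonneg
  rw [h2] at h3
  exact absurd h3 (by decide)

lemma PeriodPair.derivWeierstrassP_half_ω₁ : L.derivWeierstrassP (L.ω₁ / 2) = 0 := by
  have h := L.derivWeierstrassP_sub_coe (L.ω₁ / 2) ⟨L.ω₁, L.ω₁_mem_lattice⟩
  rw [show L.ω₁ / 2 - L.ω₁ = -(L.ω₁ / 2) by ring, L.derivWeierstrassP_neg] at h
  linear_combination (-1 / 2 : ℂ) * h

lemma PeriodPair.cubic_weierstrassP_half_ω₁ :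
    4 * L.weierstrassP (L.ω₁ / 2) ^ 3 - L.g₂ * L.weierstrassP (L.ω₁ / 2) - L.g₃ = 0 := by
  have h := L.derivWeierstrassP_sq _ L.ω₁_div_two_notMem_lattice
  rw [L.derivWeierstrassP_half_ω₁] at h
  linear_combination -h

lemma PeriodPair.deriv_derivWeierstrassP {x : ℂ} (hx : x ∉ L.lattice) :
    deriv L.derivWeierstrassP x = 6 * L.weierstrassP x ^ 2 - L.g₂ / 2 := by
  have hopen : IsOpen (L.lattice : Set ℂ)ᶜ := L.isClosed_lattice.isOpen_compl
  have key : ∀ w ∉ L.lattice, L.derivWeierstrassP w *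
      (deriv L.derivWeierstrassP w - (6 * L.weierstrassP w ^ 2 - L.g₂ / 2)) = 0 := by
    intro w hw
    have hd : HasDerivAt L.weierstrassP (L.derivWeierstrassP w) w := by
      rw [← L.deriv_weierstrassP]
      exact (L.analyticOnNhd_weierstrassP w hw).differentiableAt.hasDerivAt
    have hd' := (L.analyticOnNhd_derivWeierstrassP w hw).differentiableAt.hasDerivAt
    have heq : (fun v ↦ L.derivWeierstrassP v ^ 2) =ᶠ[𝓝 w] fun v ↦
        4 * L.weierstrassP v ^ 3 - L.g₂ * L.weierstrassP v - L.g₃ := by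
      filter_upwards [hopen.mem_nhds hw] with v hv using L.derivWeierstrassP_sq v hv
    have h := (hd'.fun_pow 2).unique
      (((((hd.fun_pow 3).const_mul 4).fun_sub (hd.const_mul L.g₂)).sub_const
        L.g₃).congr_of_eventuallyEq heq)
    push_cast at h
    linear_combination h / 2
  rcases (L.analyticOnNhd_derivWeierstrassP x hx).eventually_eq_zero_or_eventually_ne_zero
    with h | h
  · exact absurd h (L.not_eventually_derivWeierstrassP_eq_zero hx)
  · have hc1 : ContinuousAt (deriv L.derivWeierstrassP) x :=
      (L.analyticOnNhd_derivWeierstrassP x hx).deriv.continuousAt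
    have hc2 : ContinuousAt (fun w ↦ 6 * L.weierstrassP w ^ 2 - L.g₂ / 2) x :=
      (((L.analyticOnNhd_weierstrassP x hx).continuousAt.pow 2).const_mul 6).sub
        continuousAt_const
    refine tendsto_nhds_unique (hc1.tendsto.mono_left nhdsWithin_le_nhds)
      ((hc2.tendsto.mono_left nhdsWithin_le_nhds).congr' ?_ : Tendsto _ (𝓝[≠] x) _)
    filter_upwards [h, nhdsWithin_le_nhds (hopen.mem_nhds hx)] with w hw0 hw
    exact (sub_eq_zero.mp ((mul_eq_zero.mp (key w hw)).resolve_left hw0)).symm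

lemma PeriodPair.six_mul_sumInvPow_four {x : ℂ} (hx : x ∉ L.lattice) :
    6 * L.sumInvPow x 4 = 6 * L.weierstrassP x ^ 2 - L.g₂ / 2 := by
  rw [← L.deriv_derivWeierstrassP hx, ← L.deriv_derivWeierstrassPExcept_self,
    L.derivWeierstrassPExcept_of_notMem _ hx]

end WeierstrassHalfPeriod

section LatticeSums

open Topology

lemma linearIndependent_one_coe (z : ℍ) : LinearIndependent ℝ ![(1 : ℂ), (z : ℂ)] := by
  rw [LinearIndependent.pair_iff]
  intro s t h
  have him := congrArg Complex.im h
  have ht : t = 0 := by simpa [z.im_ne_zero] using him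
  subst ht
  simpa using h

/-- The pair of periods `(1, z)`. -/
def periodPair (z : ℍ) : PeriodPair := ⟨1, z, linearIndependent_one_coe z⟩

lemma hasSum_prod_of_hasSum_lattice {z : ℍ} {f : ℂ → ℂ} {s : ℂ}
    (hf : HasSum (fun l : (periodPair z).lattice ↦ f l) s) :
    HasSum (fun p : ℤ × ℤ ↦ f (p.1 * z + p.2)) s := by
  rw [← (periodPair z).latticeEquivProd.symm.toEquiv.hasSum_iff,
    ← (Equiv.prodComm ℤ ℤ).hasSum_iff] at hf
  convert hf using 2 with p
  have h := (periodPair z).latticeEquiv_symm_apply p.swap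
  refine congrArg f (Eq.trans ?_ h.symm)
  simp [periodPair, add_comm]

lemma two_mul_riemannZeta_mul_E {k : ℕ} (hk : 3 ≤ k) (z : ℍ) :
    2 * riemannZeta k * ModularForm.E hk z = (periodPair z).G k := by
  have hG := (periodPair z).hasSum_sumInvPow 0 hk
  simp only [sub_zero, PeriodPair.sumInvPow_zero] at hG
  have h := hasSum_prod_of_hasSum_lattice (f := fun w ↦ (w ^ k)⁻¹) hG
  have hE := _root_.tsum_eisSummand_eq_riemannZeta_mul_eisensteinSeries hk z
  rw [← (finTwoArrowEquiv ℤ).symm.tsum_eq] at hE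
  rw [show ModularForm.E hk z =
      (1 / 2 : ℂ) • EisensteinSeries.eisensteinSeriesSIF (N := 1) 0 k z from rfl,
    EisensteinSeries.eisensteinSeriesSIF_apply 0 k z, ← h.tsum_eq]
  simp only [EisensteinSeries.eisSummand, finTwoArrowEquiv_symm_apply, Matrix.cons_val_zero,
    Matrix.cons_val_one, zpow_neg, zpow_natCast] at hE
  rw [hE, smul_eq_mul]
  ring

lemma qexp_mul_sub_half (n : ℕ) (z : ℂ) : qexp (n * z - 1 / 2) = -qexp z ^ n := by
  rw [qexp, qexp, ← Complex.exp_nat_mul,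
    show 2 * (Real.pi : ℂ) * Complex.I * (n * z - 1 / 2) = 
      n * (2 * Real.pi * Complex.I * z) - Real.pi * Complex.I by ring,
    Complex.exp_sub, Complex.exp_pi_mul_I, div_neg, div_one]

lemma qexp_natCast_mul (n : ℕ) (z : ℂ) : qexp (n * z) = qexp z ^ n := by
  rw [qexp, qexp, ← Complex.exp_nat_mul]
  ring_nf

lemma tsum_row (z : ℍ) (n : ℕ+) {k : ℕ} (hk : 1 ≤ k) :
    ∑' m : ℤ, (((n : ℂ) * z + m) ^ (k + 1))⁻¹ = (-2 * Real.pi * Complex.I) ^ (k + 1) / k.factorial *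
      ∑' d : ℕ+, (d : ℂ) ^ k * qexp z ^ (n * d : ℕ) := by
  have h := EisensteinSeries.qExpansion_identity_pnat hk ⟨n * z, by simpa using z.2⟩
  simp only [one_div] at h
  refine h.trans (congrArg _ (tsum_congr fun d ↦ ?_))
  rw [pow_mul, ← qexp_natCast_mul]
  rfl

lemma tsum_row_sub_half (z : ℍ) (n : ℕ+) {k : ℕ} (hk : 1 ≤ k) :
    ∑' m : ℤ, (((n : ℂ) * z + m - 1 / 2) ^ (k + 1))⁻¹ =
      (-2 * Real.pi * Complex.I) ^ (k + 1) / k.factorial *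
        ∑' d : ℕ+, (-1) ^ (d : ℕ) * (d : ℂ) ^ k * qexp z ^ (n * d : ℕ) := by
  have h := EisensteinSeries.qExpansion_identity_pnat hk ⟨n * z - 1 / 2, by simpa using z.2⟩
  simp only [one_div] at h
  simp only [one_div, add_sub_right_comm]
  refine h.trans (congrArg _ (tsum_congr fun d ↦ ?_))
  have h2 : cexp (2 * Real.pi * Complex.I * (n * z - 2⁻¹)) = -qexp z ^ (n : ℕ) := by
    simpa [qexp] using qexp_mul_sub_half n z
  rw [h2, pow_mul, neg_pow]
  ring

lemma summable_row (z : ℍ) (n : ℤ) {k : ℕ} (hk : 2 ≤ k) :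
    Summable fun m : ℤ ↦ (((n : ℂ) * z + m) ^ k)⁻¹ := by
  simpa using EisensteinSeries.linear_right_summable z n (k := k) (by exact_mod_cast hk)

lemma summable_int_inv_pow {k : ℕ} (hk : 2 ≤ k) : Summable fun m : ℤ ↦ ((m : ℂ) ^ k)⁻¹ := by
  simpa using summable_row UpperHalfPlane.I 0 hk

lemma tsum_row_neg {k : ℕ} (hk : Even k) (w : ℂ) :
    ∑' m : ℤ, ((-w + m) ^ k)⁻¹ = ∑' m : ℤ, ((w + m) ^ k)⁻¹ := by
  rw [← (Equiv.neg ℤ).tsum_eq]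
  refine tsum_congr fun m ↦ ?_
  rw [← hk.neg_pow]
  simp [add_comm]

lemma tsum_row_sub_half_neg {k : ℕ} (hk : Even k) (w : ℂ) :
    ∑' m : ℤ, ((-w + m - 1 / 2) ^ k)⁻¹ = ∑' m : ℤ, ((w + m - 1 / 2) ^ k)⁻¹ := by
  rw [← (Equiv.subLeft (1 : ℤ)).tsum_eq]
  refine tsum_congr fun m ↦ ?_
  rw [← hk.neg_pow]
  congr 2
  simp only [Equiv.subLeft_apply]
  push_cast
  ring

lemma HasSum.int_even_add_odd {f : ℤ → ℂ} {a b : ℂ} (he : HasSum (fun m ↦ f (2 * m)) a)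
    (ho : HasSum (fun m ↦ f (2 * m - 1)) b) : HasSum f (a + b) := by
  have ho' : HasSum (fun m ↦ f (2 * m + 1)) b := by
    rw [← (Equiv.addRight (1 : ℤ)).hasSum_iff] at ho
    convert ho using 3 with m
    simp only [Function.comp_apply, Equiv.coe_addRight]
    ring_nf
  have hinj : Function.Injective fun m : ℤ ↦ 2 * m := mul_right_injective₀ two_ne_zero
  have hinj' := ((add_left_injective (1 : ℤ)).comp hinj).hasSum_range_iff.2 ho'
  refine (hinj.hasSum_range_iff.2 he).add_isCompl ?_ hinj'
  simpa [Function.comp_def] using Int.isCompl_even_odd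

lemma hasSum_int_sub_half {k : ℕ} (hk : 2 ≤ k) (hk2 : Even k) :
    HasSum (fun m : ℤ ↦ (((m : ℂ) - 1 / 2) ^ k)⁻¹) ((2 ^ k - 1) * (2 * riemannZeta k)) := by
  have hs := summable_int_inv_pow hk
  have hodd : Summable fun m : ℤ ↦ (((2 * m - 1 : ℤ) : ℂ) ^ k)⁻¹ :=
    hs.comp_injective (i := fun m : ℤ ↦ 2 * m - 1) fun a b h ↦ by simpa using h
  have heven : HasSum (fun m : ℤ ↦ (((2 * m : ℤ) : ℂ) ^ k)⁻¹) ((2 ^ k)⁻¹ * (2 * riemannZeta k)) := by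
    have h := hs.hasSum.mul_left ((2 : ℂ) ^ k)⁻¹
    rw [← two_mul_riemannZeta_eq_tsum_int_inv_pow_of_even hk hk2] at h
    simpa [mul_pow, mul_comm] using h
  have heq := (HasSum.int_even_add_odd (f := fun m : ℤ ↦ ((m : ℂ) ^ k)⁻¹)
    heven hodd.hasSum).unique hs.hasSum
  rw [← two_mul_riemannZeta_eq_tsum_int_inv_pow_of_even hk hk2, ← eq_sub_iff_add_eq'] at heq
  have h := hodd.hasSum.mul_left ((2 : ℂ) ^ k)
  rw [heq] at h
  have hf : (fun m : ℤ ↦ (((m : ℂ) - 1 / 2) ^ k)⁻¹) =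
      fun m : ℤ ↦ 2 ^ k * (((2 * m - 1 : ℤ) : ℂ) ^ k)⁻¹ := by
    funext m
    rw [show (m : ℂ) - 1 / 2 = ((2 * m - 1 : ℤ) : ℂ) / 2 by push_cast; ring, div_pow, inv_div,
      div_eq_mul_inv]
  rw [mul_sub, mul_inv_cancel_left₀ (pow_ne_zero k two_ne_zero)] at h
  rw [hf, sub_one_mul]
  exact h

end LatticeSums

section LatticeValues

open Topology

lemma eq_row_zero_add_two_mul_tsum_rows {z : ℍ} {f : ℂ → ℂ} {s : ℂ}
    (hf : HasSum (fun l : (periodPair z).lattice ↦ f l) s)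
    (heven : ∀ w : ℂ, ∑' m : ℤ, f (-w + m) = ∑' m : ℤ, f (w + m)) :
    s = ∑' m : ℤ, f m + 2 * ∑' n : ℕ+, ∑' m : ℤ, f (n * z + m) := by
  have h := hasSum_prod_of_hasSum_lattice hf
  rw [← h.tsum_eq, h.summable.tsum_prod, tsum_int_eq_zero_add_two_mul_tsum_pnat]
  · simp
  · intro n
    simpa using heven (n * z)
  · exact h.summable.prod

lemma sumInvPow_half_four (z : ℍ) :
    (periodPair z).sumInvPow (1 / 2) 4 = Real.pi ^ 4 / 3 * E04 z := by
  have hev : Even 4 := by decide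
  have hs := (periodPair z).hasSum_sumInvPow (1 / 2) (by norm_num : 2 < 4)
  have h := eq_row_zero_add_two_mul_tsum_rows (f := fun w ↦ ((w - 1 / 2) ^ 4)⁻¹) hs
    (tsum_row_sub_half_neg hev)
  rw [h, (hasSum_int_sub_half (by norm_num) hev).tsum_eq]
  have hrow (n : ℕ+) : ∑' m : ℤ, (((n : ℂ) * z + m - 1 / 2) ^ 4)⁻¹ =
      (-2 * Real.pi * Complex.I) ^ 4 / 6 *
        ∑' d : ℕ+, (-1) ^ (d : ℕ) * (d : ℂ) ^ 3 * qexp z ^ (n * d : ℕ) :=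
    (tsum_row_sub_half z n (by norm_num)).trans (by norm_num [Nat.factorial])
  simp only [hrow, tsum_mul_left]
  rw [tsum_tsum_mul_pow (g := fun d ↦ (-1) ^ d * (d : ℂ) ^ 3) (k := 3) (fun d ↦ by simp)
    (norm_qexp_lt_one z.im_pos)]
  simp only [E04, sigma3Alt]
  push_cast
  rw [riemannZeta_four, mul_pow _ Complex.I, Complex.I_pow_four]
  ring

lemma weierstrassP_half (z : ℍ) :
    (periodPair z).weierstrassP (1 / 2) = 2 * Real.pi ^ 2 / 3 * Egamma2 z := by
  have hev : Even 2 := by decide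
  have hsum (w : ℂ) : ∑' m : ℤ, (((w + m - 1 / 2) ^ 2)⁻¹ - ((w + m) ^ 2)⁻¹) =
      ∑' m : ℤ, ((w + m - 1 / 2) ^ 2)⁻¹ - ∑' m : ℤ, ((w + m) ^ 2)⁻¹ := by
    refine Summable.tsum_sub ?_ ?_
    · simpa [add_sub_right_comm] using
        EisensteinSeries.linear_right_summable (w - 1 / 2) 1 (k := 2) le_rfl
    · simpa using EisensteinSeries.linear_right_summable w 1 (k := 2) le_rfl
  have hf := (periodPair z).hasSum_weierstrassP (1 / 2)
  have h := eq_row_zero_add_two_mul_tsum_rows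
    (f := fun w ↦ ((w - 1 / 2) ^ 2)⁻¹ - (w ^ 2)⁻¹) (by
      convert hf using 2 with l
      rw [one_div, one_div (_ ^ 2), one_div (_ ^ 2), ← hev.neg_pow, neg_sub]) (fun w ↦ by
      simp only [hsum, tsum_row_sub_half_neg hev, tsum_row_neg hev])
  have h0 := hsum 0
  simp only [zero_add] at h0
  rw [h, h0, (hasSum_int_sub_half le_rfl hev).tsum_eq,
    ← two_mul_riemannZeta_eq_tsum_int_inv_pow_of_even le_rfl hev]
  have hrow (n : ℕ+) : ∑' m : ℤ, (((n * (z : ℂ) + m - 1 / 2) ^ 2)⁻¹ - ((n * (z : ℂ) + m) ^ 2)⁻¹) =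
      8 * Real.pi ^ 2 *
        ∑' d : ℕ+, (if Odd (d : ℕ) then ((d : ℕ) : ℂ) else 0) * qexp z ^ (n * d : ℕ) := by
    have hr : ‖qexp z ^ (n : ℕ)‖ < 1 := by
      rw [norm_pow]
      exact pow_lt_one₀ (norm_nonneg _) (norm_qexp_lt_one z.im_pos) n.ne_zero
    rw [hsum, tsum_row_sub_half z n (k := 1) le_rfl, tsum_row z n (k := 1) le_rfl, ← mul_sub,
      ← Summable.tsum_sub, ← tsum_mul_left, ← tsum_mul_left]
    · refine tsum_congr fun d ↦ ?_
      rw [mul_pow _ Complex.I, Complex.I_sq]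
      rcases Nat.even_or_odd d with hd | hd
      · simp [hd.neg_one_pow, Nat.not_odd_iff_even.mpr hd]
      · simp only [hd.neg_one_pow, hd, if_true]
        simp
        ring
    · simpa only [pow_mul] using
        summable_qSeries (a := fun d ↦ (-1) ^ d * (d : ℂ) ^ 1) (k := 1) (fun d ↦ by simp) hr
    · simpa only [pow_mul] using
        summable_qSeries (a := fun d ↦ (d : ℂ) ^ 1) (k := 1) (fun d ↦ by simp) hr
  simp only [hrow, tsum_mul_left]
  rw [tsum_tsum_mul_pow (g := fun d ↦ if Odd d then (d : ℂ) else 0) (k := 1)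
    (fun d ↦ by split_ifs <;> simp) (norm_qexp_lt_one z.im_pos)]
  simp only [Egamma2, sigmaOdd, Finset.sum_filter]
  push_cast
  rw [riemannZeta_two]
  ring

lemma G_four_eq (z : ℍ) : (periodPair z).G 4 = Real.pi ^ 4 / 45 * ModularForm.E₄ z := by
  rw [← two_mul_riemannZeta_mul_E (by norm_num : 3 ≤ 4) z]
  push_cast
  rw [riemannZeta_four]
  change _ = _ * ModularForm.E _ z
  ring

lemma riemannZeta_six : riemannZeta 6 = (Real.pi : ℂ) ^ 6 / 945 := by
  have h := riemannZeta_two_mul_nat (k := 3) (by norm_num)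
  have hb : bernoulli 6 = 1 / 42 := by decide +kernel
  norm_num [hb, Nat.factorial] at h
  rw [h]
  ring

lemma G_six_eq (z : ℍ) : (periodPair z).G 6 = 2 * Real.pi ^ 6 / 945 * ModularForm.E₆ z := by
  rw [← two_mul_riemannZeta_mul_E (by norm_num : 3 ≤ 6) z]
  push_cast
  rw [riemannZeta_six]
  change _ = _ * ModularForm.E _ z
  ring

lemma E₄_eq_E04_add (z : ℍ) : ModularForm.E₄ z = E04 z + 256 * Einf4 z := by
  have hb : bernoulli 4 = -1 / 30 := by decide +kernel
  have h := EisensteinSeries.q_expansion_bernoulli (by norm_num : 3 ≤ 4) (by decide) z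
  have hr := norm_qexp_lt_one z.im_pos
  have hs : ∑' n : ℕ+, (sigma3Alt n : ℂ) * qexp z ^ (n : ℕ) +
      16 * ∑' n : ℕ+, (sigmaStar3 n : ℂ) * qexp z ^ (n : ℕ) =
      15 * ∑' n : ℕ+, (ArithmeticFunction.sigma 3 n : ℂ) * qexp z ^ (n : ℕ) := by
    rw [← tsum_mul_left, ← tsum_mul_left, ← Summable.tsum_add (summable_qSeries norm_sigma3Alt_le hr)
      ((summable_qSeries norm_sigmaStar3_le hr).mul_left 16)]
    refine tsum_congr fun n ↦ ?_
    have hn := congrArg (Int.cast : ℤ → ℂ) (fifteen_mul_sigma_three n)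
    push_cast at hn
    linear_combination -qexp z ^ (n : ℕ) * hn
  have h' : ModularForm.E₄ z =
      1 + 240 * ∑' n : ℕ+, (ArithmeticFunction.sigma 3 n : ℂ) * qexp z ^ (n : ℕ) := by
    refine h.trans ?_
    simp only [hb, zpow_natCast, qexp]
    norm_num
  rw [h', E04, Einf4]
  linear_combination -16 * hs

lemma cubic_relation (z : ℍ) :
    ModularForm.E₆ z = 4 * Egamma2 z ^ 3 - 3 * ModularForm.E₄ z * Egamma2 z := by
  have h := (periodPair z).cubic_weierstrassP_half_ω₁
  simp only [PeriodPair.g₂, PeriodPair.g₃, G_four_eq, G_six_eq] at h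
  rw [show (periodPair z).ω₁ = 1 from rfl, weierstrassP_half] at h
  have hpi : (Real.pi : ℂ) ^ 6 ≠ 0 := pow_ne_zero 6 (by exact_mod_cast Real.pi_ne_zero)
  refine mul_left_cancel₀ hpi ?_
  linear_combination (-27 / 8 : ℂ) * h

lemma quadratic_relation (z : ℍ) :
    ModularForm.E₄ z = 4 * Egamma2 z ^ 2 - 3 * E04 z := by
  have h := (periodPair z).six_mul_sumInvPow_four (periodPair z).ω₁_div_two_notMem_lattice
  simp only [PeriodPair.g₂, G_four_eq] at h
  rw [show (periodPair z).ω₁ = 1 from rfl, weierstrassP_half, sumInvPow_half_four] at h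
  have hpi : (Real.pi : ℂ) ^ 4 ≠ 0 := pow_ne_zero 4 (by exact_mod_cast Real.pi_ne_zero)
  refine mul_left_cancel₀ hpi ?_
  linear_combination (3 / 2 : ℂ) * h

lemma E04_eq (z : ℍ) : E04 z = Egamma2 z ^ 2 - 64 * Einf4 z := by
  linear_combination (quadratic_relation z - E₄_eq_E04_add z) / 4

lemma E₄_eq (z : ℍ) : ModularForm.E₄ z = Egamma2 z ^ 2 + 192 * Einf4 z := by
  linear_combination E₄_eq_E04_add z + E04_eq z

lemma E₆_eq (z : ℍ) : ModularForm.E₆ z = Egamma2 z ^ 3 - 576 * Egamma2 z * Einf4 z := by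
  linear_combination cubic_relation z - 3 * Egamma2 z * E₄_eq z

end LatticeValues

section MainResult

open Topology Derivative

lemma E₄_cube_sub_E₆_sq (z : ℍ) :
    ModularForm.E₄ z ^ 3 - ModularForm.E₆ z ^ 2 = 1728 * E04 z ^ 2 * Einf4 z := by
  rw [E₄_eq, E₆_eq, E04_eq]
  ring

lemma E04_sq_mul_Einf4_ne_zero (z : ℍ) : E04 z ^ 2 * Einf4 z ≠ 0 := by
  have h := ModularForm.discriminant_ne_zero z
  rw [ModularForm.discriminant_eq_E₄_cube_sub_E₆_sq, E₄_cube_sub_E₆_sq] at h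
  intro h0
  exact h (by rw [mul_assoc, h0]; simp)

lemma differentiableAt_Egamma2 {z : ℂ} (hz : 0 < z.im) : DifferentiableAt ℂ Egamma2 z :=
  ((differentiableAt_qSeries norm_sigmaOdd_le hz).const_mul 24).const_add 1

lemma differentiableAt_Einf4 {z : ℂ} (hz : 0 < z.im) : DifferentiableAt ℂ Einf4 z :=
  differentiableAt_qSeries norm_sigmaStar3_le hz

lemma deriv_comp_ofComplex_eq {F : ℍ → ℂ} {f : ℂ → ℂ} {f' : ℂ} {z : ℍ} (h : ∀ w : ℍ, F w = f w)
    (hf : HasDerivAt f f' z) : normalizedDerivOfComplex F z = (2 * Real.pi * Complex.I)⁻¹ * f' := by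
  have heq : F ∘ ofComplex =ᶠ[𝓝 (z : ℂ)] f := by
    filter_upwards [isOpen_upperHalfPlaneSet.mem_nhds z.im_pos] with w hw
    rw [Function.comp_apply, ofComplex_apply_of_im_pos hw, h]
  rw [normalizedDerivOfComplex, heq.deriv_eq, hf.deriv]

/-- The Wronskian-type relation between `Egamma2` and `Einf4`. -/
lemma two_mul_Einf4_mul_deriv_sub (z : ℍ) :
    2 * Einf4 z * deriv Egamma2 z - Egamma2 z * deriv Einf4 z =
      -(2 * Real.pi * Complex.I) * (E04 z * Einf4 z) := by
  have hA := (differentiableAt_Egamma2 z.im_pos).hasDerivAt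
  have hC := (differentiableAt_Einf4 z.im_pos).hasDerivAt
  have h4 := deriv_comp_ofComplex_eq E₄_eq ((hA.fun_pow 2).fun_add (hC.const_mul 192))
  have h6 := deriv_comp_ofComplex_eq E₆_eq
    ((hA.fun_pow 3).fun_sub ((hA.const_mul 576).fun_mul hC))
  rw [normalizedDeriv_E₄, eq_inv_mul_iff_mul_eq₀ two_pi_I_ne_zero] at h4
  rw [normalizedDeriv_E₆, eq_inv_mul_iff_mul_eq₀ two_pi_I_ne_zero] at h6
  have hB : E04 z ≠ 0 := fun h ↦ E04_sq_mul_Einf4_ne_zero z (by simp [h])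
  refine mul_left_cancel₀ (mul_ne_zero (by norm_num : (1728 : ℂ) ≠ 0) hB) ?_
  rw [E₄_eq, E₆_eq] at h4 h6
  rw [E04_eq]
  push_cast at h4 h6
  linear_combination 3 * (Egamma2 z ^ 3 - 576 * Egamma2 z * Einf4 z) * h4 -
    2 * (Egamma2 z ^ 2 + 192 * Einf4 z) * h6

end MainResult

/-- Proposition 2.7: `(d/dz) j₂(z) = −2πi · E_{γ,2}(z) E_{0,4}(z) E_{∞,4}(z)⁻¹` on the
upper half-plane. -/
theorem stmt11 (z : ℂ) (hz : 0 < z.im) :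
    HasDerivAt j2
      (-2 * Real.pi * Complex.I * Egamma2 z * E04 z * (Einf4 z)⁻¹) z := by
  have hA := (differentiableAt_Egamma2 hz).hasDerivAt
  have hC := (differentiableAt_Einf4 hz).hasDerivAt
  have hC0 : Einf4 z ≠ 0 := fun h ↦ E04_sq_mul_Einf4_ne_zero ⟨z, hz⟩ (by simp [h])
  have hW := two_mul_Einf4_mul_deriv_sub ⟨z, hz⟩
  convert! (hA.fun_pow 2).fun_div hC hC0 using 1
  field_simp
  push_cast
  linear_combination -Egamma2 z * hW

end
end

section
/- Let h be a positive even integer and r = ⌊h/4⌋ + 1. Define W_2 on M(2,h) by W_2(f) = f·E_{∞,4}^{−h/4} if h ≡ 0 (mod 4) and W_2(f) = f·E_{γ,2}·E_{∞,4}^{−(h+2)/4} if h ≡ 2 (mod 4). Then W_2 restricted to M(2,h) is a vector space isomorphism onto the space of polynomials in j_2 of degree at most r−1 when h ≡ 0 (mod 4), and onto the space of polynomials in j_2 with zero constant term and degree at most r when h ≡ 2 (mod 4). -/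
open Complex Filter UpperHalfPlane
open scoped MatrixGroups ModularForm Manifold

noncomputable section

open CongruenceSubgroup ModularForm Asymptotics EisensteinSeries
open scoped Topology

/-- `F` underlies a modular form of weight `k` for `Γ₀(2)`. -/
def IsGamma0TwoForm (k : ℤ) (F : ℍ → ℂ) : Prop :=
  ∃ f : ModularForm (Gamma0 2) k, ⇑f = F

/-- `diag(2, 1)`. -/
def diagTwoOne : GL (Fin 2) ℝ := .mkOfDetNeZero !![2, 0; 0, 1] (by simp)

/-- `diag(1, 2)`. -/
def diagOneTwo : GL (Fin 2) ℝ := .mkOfDetNeZero !![1, 0; 0, 2] (by simp)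

lemma diagTwoOne_mul_S :
    diagTwoOne * (ModularGroup.S : GL (Fin 2) ℝ) = (ModularGroup.S : GL (Fin 2) ℝ) * diagOneTwo := by
  ext i j
  fin_cases i <;> fin_cases j <;> simp [diagTwoOne, diagOneTwo, ModularGroup.coe_S,
    Matrix.SpecialLinearGroup.map_apply_coe,
    Matrix.mul_apply, Matrix.GeneralLinearGroup.mkOfDetNeZero]

lemma exists_diagTwoOne_mul {γ : SL(2, ℤ)} (hγ : γ ∈ Gamma0 2) :
    ∃ δ : SL(2, ℤ), diagTwoOne * (γ : GL (Fin 2) ℝ) = (δ : GL (Fin 2) ℝ) * diagTwoOne ∧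
      γ 1 0 = 2 * δ 1 0 ∧ γ 1 1 = δ 1 1 := by
  rw [Gamma0_mem, ZMod.intCast_zmod_eq_zero_iff_dvd] at hγ
  obtain ⟨c, hc⟩ := hγ
  push_cast at hc
  have hdet := γ.det_coe
  rw [Matrix.det_fin_two, hc] at hdet
  obtain ⟨δ, hδ⟩ : ∃ δ : SL(2, ℤ), (δ : Matrix (Fin 2) (Fin 2) ℤ) =
      !![γ 0 0, 2 * γ 0 1; c, γ 1 1] :=
    ⟨⟨_, by rw [Matrix.det_fin_two_of]; linarith⟩, rfl⟩
  refine ⟨δ, ?_, by simp [hδ, hc], by simp [hδ]⟩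
  ext i j
  fin_cases i <;> fin_cases j <;> simp [diagTwoOne, Matrix.mul_apply, hc, hδ,
    Matrix.SpecialLinearGroup.map_apply_coe, Matrix.GeneralLinearGroup.mkOfDetNeZero, mul_comm]

lemma exists_eq_mul_S_mul_T_zpow (γ : SL(2, ℤ)) :
    γ ∈ Gamma0 2 ∨ ∃ δ ∈ Gamma0 2, ∃ j : ℤ, γ = δ * (ModularGroup.S * ModularGroup.T ^ j) := by
  by_cases h : γ ∈ Gamma0 2
  · exact .inl h
  refine .inr ⟨γ * (ModularGroup.S * ModularGroup.T ^ (γ 1 1))⁻¹, ?_, γ 1 1, by group⟩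
  rw [Gamma0_mem, ZMod.intCast_zmod_eq_zero_iff_dvd] at h ⊢
  have hT : (ModularGroup.T ^ (γ 1 1) : SL(2, ℤ))⁻¹ = ModularGroup.T ^ (-(γ 1 1)) := by simp
  rw [mul_inv_rev, hT]
  have : (γ * (ModularGroup.T ^ (-(γ 1 1)) * ModularGroup.S⁻¹)) 1 0 = γ 1 1 * (γ 1 0 - 1) := by
    simp [ModularGroup.coe_T_zpow, ModularGroup.coe_S, Matrix.mul_apply, Fin.sum_univ_two,
      Matrix.adjugate_fin_two, Matrix.SpecialLinearGroup.coe_inv]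
    ring
  rw [this]
  push_cast at h ⊢
  apply Dvd.dvd.mul_left
  omega

lemma isBoundedAtImInfty_slash_T_zpow {k : ℤ} {F : ℍ → ℂ} (hF : IsBoundedAtImInfty F) (j : ℤ) :
    IsBoundedAtImInfty (F ∣[k] (ModularGroup.T ^ j : SL(2, ℤ))) := by
  rw [SL_slash]
  refine hF.slash k ?_
  simp [-map_zpow, ModularGroup.coe_T_zpow, Matrix.SpecialLinearGroup.map_apply_coe]

lemma IsGamma0TwoForm.mk {k : ℤ} {F : ℍ → ℂ} (hol : MDiff F)
    (hinv : ∀ γ ∈ Gamma0 2, F ∣[k] γ = F) (hinf : IsBoundedAtImInfty F)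
    (hS : IsBoundedAtImInfty (F ∣[k] ModularGroup.S)) : IsGamma0TwoForm k F := by
  refine ⟨{ toFun := F, slash_action_eq' := ?_, holo' := hol, bdd_at_cusps' := ?_ }, rfl⟩
  · rintro - ⟨γ, hγ, rfl⟩
    exact hinv γ hγ
  · intro c hc
    rw [Subgroup.IsArithmetic.isCusp_iff_isCusp_SL2Z] at hc
    rw [OnePoint.isBoundedAt_iff_forall_SL2Z hc]
    rintro γ -
    rcases exists_eq_mul_S_mul_T_zpow γ with h | ⟨δ, hδ, j, rfl⟩
    · rwa [hinv γ h]
    · rw [SlashAction.slash_mul, hinv δ hδ, SlashAction.slash_mul]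
      exact isBoundedAtImInfty_slash_T_zpow hS j

namespace IsGamma0TwoForm

variable {k l : ℤ} {F G : ℍ → ℂ}

lemma mdifferentiable (hF : IsGamma0TwoForm k F) : MDiff F := by
  obtain ⟨f, rfl⟩ := hF
  exact f.holo'

lemma slash_eq (hF : IsGamma0TwoForm k F) {γ : SL(2, ℤ)} (hγ : γ ∈ Gamma0 2) : F ∣[k] γ = F := by
  obtain ⟨f, rfl⟩ := hF
  exact f.slash_action_eq' _ ⟨γ, hγ, rfl⟩

lemma isBoundedAtImInfty_slash (hF : IsGamma0TwoForm k F) (γ : SL(2, ℤ)) :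
    IsBoundedAtImInfty (F ∣[k] γ) := by
  obtain ⟨f, rfl⟩ := hF
  exact ModularFormClass.bdd_at_infty_slash f γ

lemma isBoundedAtImInfty (hF : IsGamma0TwoForm k F) : IsBoundedAtImInfty F := by
  simpa using hF.isBoundedAtImInfty_slash 1

lemma add (hF : IsGamma0TwoForm k F) (hG : IsGamma0TwoForm k G) : IsGamma0TwoForm k (F + G) := by
  obtain ⟨f, rfl⟩ := hF
  obtain ⟨g, rfl⟩ := hG
  exact ⟨f + g, rfl⟩

lemma sub (hF : IsGamma0TwoForm k F) (hG : IsGamma0TwoForm k G) : IsGamma0TwoForm k (F - G) := by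
  obtain ⟨f, rfl⟩ := hF
  obtain ⟨g, rfl⟩ := hG
  exact ⟨f - g, rfl⟩

lemma smul (c : ℂ) (hF : IsGamma0TwoForm k F) : IsGamma0TwoForm k (c • F) := by
  obtain ⟨f, rfl⟩ := hF
  exact ⟨c • f, rfl⟩

lemma mul (hF : IsGamma0TwoForm k F) (hG : IsGamma0TwoForm l G) :
    IsGamma0TwoForm (k + l) (F * G) := by
  obtain ⟨f, rfl⟩ := hF
  obtain ⟨g, rfl⟩ := hG
  exact ⟨f.mul g, rfl⟩

lemma pow (hF : IsGamma0TwoForm k F) (n : ℕ) : IsGamma0TwoForm (n * k) (F ^ n) := by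
  obtain ⟨f, rfl⟩ := hF
  exact ⟨f.pow n, f.coe_pow n⟩

/-- The quotient of two forms is a form if the denominator has no zeros on `ℍ` and dominates the
numerator at both cusps. -/
lemma div (hF : IsGamma0TwoForm k F) (hG : IsGamma0TwoForm l G) (hG0 : ∀ z, G z ≠ 0)
    (hinf : F =O[atImInfty] G)
    (hS : (F ∣[k] ModularGroup.S) =O[atImInfty] (G ∣[l] ModularGroup.S)) :
    IsGamma0TwoForm (k - l) (F / G) := by
  have key {A B : ℍ → ℂ} (h : A =O[atImInfty] B) : IsBoundedAtImInfty (A / B) := by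
    have := h.mul (isBigO_refl (fun z ↦ (B z)⁻¹) atImInfty)
    refine (this.trans (.of_bound 1 (.of_forall fun z ↦ ?_))).congr_left
      (fun z ↦ by simp [div_eq_mul_inv])
    by_cases hz : B z = 0 <;> simp [hz]
  refine .mk ?_ (fun γ hγ ↦ ?_) (key hinf) ?_
  · have h1 := UpperHalfPlane.mdifferentiable_iff.mp hF.mdifferentiable
    have h2 := UpperHalfPlane.mdifferentiable_iff.mp hG.mdifferentiable
    exact UpperHalfPlane.mdifferentiable_iff.mpr (h1.div h2 fun z _ ↦ hG0 _)
  · rw [div_slash_SL2, hF.slash_eq hγ, hG.slash_eq hγ]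
  · rw [div_slash_SL2]
    exact key hS

end IsGamma0TwoForm

/-- For `f` of level one and weight `k`, the function `f(2z)` (up to a constant) is a form for
`Γ₀(2)`. -/
lemma isGamma0TwoForm_slash_diagTwoOne {k : ℤ} (f : ModularForm 𝒮ℒ k) :
    IsGamma0TwoForm k (⇑f ∣[k] diagTwoOne) := by
  have hinv (γ : SL(2, ℤ)) : ⇑f ∣[k] (γ : GL (Fin 2) ℝ) = f := f.slash_action_eq' _ ⟨γ, rfl⟩
  refine .mk (f.holo'.slash k _) (fun γ hγ ↦ ?_) ?_ ?_
  · obtain ⟨δ, hδ, -⟩ := exists_diagTwoOne_mul hγ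
    rw [SL_slash, ← SlashAction.slash_mul, hδ, SlashAction.slash_mul, hinv]
  · exact (ModularFormClass.bdd_at_infty f).slash k
      (by simp [diagTwoOne, Matrix.GeneralLinearGroup.mkOfDetNeZero])
  · rw [SL_slash, ← SlashAction.slash_mul, diagTwoOne_mul_S, SlashAction.slash_mul, hinv]
    exact (ModularFormClass.bdd_at_infty f).slash k
      (by simp [diagOneTwo, Matrix.GeneralLinearGroup.mkOfDetNeZero])

lemma isGamma0TwoForm_of_levelOne {k : ℤ} (f : ModularForm 𝒮ℒ k) : IsGamma0TwoForm k f := by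
  have hinv (γ : SL(2, ℤ)) : ⇑f ∣[k] γ = f := f.slash_action_eq' _ ⟨γ, rfl⟩
  have hb := ModularFormClass.bdd_at_infty f
  exact .mk f.holo' (fun γ _ ↦ hinv γ) hb (by rwa [hinv])

open ArithmeticFunction in
lemma sigmaStar3_add_sigma_half {n : ℕ} (hn : n ≠ 0) :
    sigmaStar3 n + (if 2 ∣ n then sigma 3 (n / 2) else 0) = sigma 3 n := by
  rw [sigma_apply (n := n), ← Finset.sum_filter_add_sum_filter_not n.divisors (fun d ↦ Odd (n / d)),
    sigmaStar3]
  congr 1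
  split_ifs with h
  · rw [sigma_apply]
    congr 1
    ext d
    obtain ⟨m, rfl⟩ := h
    simp only [Nat.mem_divisors, Finset.mem_filter, Nat.not_odd_iff_even]
    rw [Nat.mul_div_cancel_left m two_pos]
    constructor
    · rintro ⟨⟨e, rfl⟩, hm⟩
      have hd : 0 < d := Nat.pos_of_ne_zero (by rintro rfl; simp at hm)
      refine ⟨⟨⟨2 * e, by ring⟩, hn⟩, ?_⟩
      rw [show 2 * (d * e) = d * (2 * e) by ring, Nat.mul_div_cancel_left _ hd]
      exact even_two_mul e
    · rintro ⟨⟨⟨e, he⟩, -⟩, hev⟩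
      have hd : 0 < d := Nat.pos_of_ne_zero (by rintro rfl; simp at he; omega)
      rw [he, Nat.mul_div_cancel_left _ hd] at hev
      obtain ⟨x, rfl⟩ := hev.two_dvd
      exact ⟨⟨x, by linarith⟩, by omega⟩
  · symm
    apply Finset.sum_eq_zero
    intro d hd
    simp only [Nat.mem_divisors, Finset.mem_filter, Nat.not_odd_iff_even] at hd
    exact absurd (hd.2.two_dvd.trans (Nat.div_dvd_of_dvd hd.1.1)) h

open ArithmeticFunction in
lemma sigmaOdd_add_sigma_half {n : ℕ} (hn : n ≠ 0) :
    sigmaOdd n + 2 * (if 2 ∣ n then sigma 1 (n / 2) else 0) = sigma 1 n := by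
  rw [sigma_one_apply n, ← Finset.sum_filter_add_sum_filter_not n.divisors (fun d ↦ Odd d),
    sigmaOdd]
  congr 1
  split_ifs with h
  · obtain ⟨m, rfl⟩ := h
    rw [sigma_one_apply, Nat.mul_div_cancel_left m two_pos, Finset.mul_sum]
    refine Finset.sum_nbij (2 * ·) (fun d hd ↦ ?_) (fun _ _ _ _ h ↦ by simpa using h)
      (fun d hd ↦ ?_) fun _ _ ↦ rfl
    · simp only [Nat.mem_divisors, Finset.mem_filter, Nat.not_odd_iff_even] at hd ⊢
      exact ⟨⟨mul_dvd_mul_left 2 hd.1, hn⟩, even_two_mul d⟩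
    · simp only [Nat.mem_divisors, Finset.coe_filter, Set.mem_ofPred_eq, Nat.not_odd_iff_even] at hd
      obtain ⟨e, rfl⟩ := hd.2.two_dvd
      exact ⟨e, by simpa using ⟨Nat.dvd_of_mul_dvd_mul_left two_pos hd.1.1, by omega⟩, rfl⟩
  · symm
    rw [mul_zero]
    apply Finset.sum_eq_zero
    intro d hd
    simp only [Nat.mem_divisors, Finset.mem_filter, Nat.not_odd_iff_even] at hd
    exact absurd (hd.2.two_dvd.trans hd.1.1) h

lemma hasSum_pow_of_hasSum_sq_pow {a : ℕ → ℂ} {q s : ℂ}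
    (h : HasSum (fun n : ℕ+ ↦ a n * (q ^ 2) ^ (n : ℕ)) s) :
    HasSum (fun n : ℕ+ ↦ (if 2 ∣ (n : ℕ) then a (n / 2) else 0) * q ^ (n : ℕ)) s := by
  have hinj : Function.Injective (fun n : ℕ+ ↦ 2 * n) := mul_right_injective 2
  rw [← hinj.hasSum_iff]
  · convert! h using 2 with n
    simp [pow_mul]
  · intro n hn
    rw [if_neg, zero_mul]
    rintro ⟨m, hm⟩
    exact hn ⟨⟨m, by have := n.pos; omega⟩, PNat.eq hm.symm⟩

lemma slash_diagTwoOne_apply (k : ℤ) (F : ℍ → ℂ) (z : ℍ) :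
    (F ∣[k] diagTwoOne) z = 2 ^ (k - 1) * F (diagTwoOne • z) := by
  simp [slash_apply, diagTwoOne, Matrix.GeneralLinearGroup.mkOfDetNeZero, denom, σ, mul_comm]

lemma slash_diagOneTwo_apply (k : ℤ) (F : ℍ → ℂ) (z : ℍ) :
    (F ∣[k] diagOneTwo) z = 2⁻¹ * F (diagOneTwo • z) := by
  simp [slash_apply, diagOneTwo, Matrix.GeneralLinearGroup.mkOfDetNeZero, denom, σ, mul_comm]
  have : (2 : ℂ) ^ k ≠ 0 := zpow_ne_zero _ two_ne_zero
  rw [zpow_sub_one₀ two_ne_zero]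
  field_simp

lemma coe_diagTwoOne_smul (z : ℍ) : ((diagTwoOne • z : ℍ) : ℂ) = 2 * z := by
  rw [coe_smul_of_det_pos (by simp [diagTwoOne])]
  simp [num, denom, diagTwoOne, Matrix.GeneralLinearGroup.mkOfDetNeZero]

lemma coe_diagOneTwo_smul (z : ℍ) : ((diagOneTwo • z : ℍ) : ℂ) = z / 2 := by
  rw [coe_smul_of_det_pos (by simp [diagOneTwo])]
  simp [num, denom, diagOneTwo, Matrix.GeneralLinearGroup.mkOfDetNeZero]

lemma hasSum_sigma (k : ℕ) (z : ℍ) :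
    HasSum (fun n : ℕ+ ↦ (ArithmeticFunction.sigma k n : ℂ) * qexp z ^ (n : ℕ))
      (∑' n : ℕ+, (ArithmeticFunction.sigma k n : ℂ) * qexp z ^ (n : ℕ)) :=
  ((EisensteinSeries.summable_sigma_mul_cexp_pow (k := k + 1) (by simp) z).comp_injective
    PNat.coe_injective).hasSum

lemma qexp_diagTwoOne_smul (z : ℍ) : qexp (diagTwoOne • z : ℍ) = qexp z ^ 2 := by
  rw [coe_diagTwoOne_smul, qexp, qexp, ← Complex.exp_nat_mul]
  push_cast
  ring_nf

lemma E2_eq_qexp (z : ℍ) : EisensteinSeries.E2 z =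
    1 - 24 * ∑' n : ℕ+, (ArithmeticFunction.sigma 1 n : ℂ) * qexp z ^ (n : ℕ) :=
  EisensteinSeries.E2_eq_tsum_cexp z

lemma E₄_eq_qexp (z : ℍ) : E₄ z =
    1 + 240 * ∑' n : ℕ+, (ArithmeticFunction.sigma 3 n : ℂ) * qexp z ^ (n : ℕ) := by
  rw [EisensteinSeries.q_expansion_bernoulli _ (by decide)]
  simp only [zpow_natCast, qexp]
  norm_num [bernoulli, bernoulli'_four]

lemma hasSum_Egamma2 (z : ℍ) :
    HasSum (fun n : ℕ+ ↦ (sigmaOdd n : ℂ) * qexp z ^ (n : ℕ))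
      ((((E2 ∣[(2 : ℤ)] diagTwoOne) - E2) z - 1) / 24) := by
  have h1 := hasSum_sigma 1 z
  have h2 := hasSum_sigma 1 (diagTwoOne • z)
  simp_rw [qexp_diagTwoOne_smul] at h2
  have h3 := h1.sub ((hasSum_pow_of_hasSum_sq_pow
    (a := fun n ↦ (ArithmeticFunction.sigma 1 n : ℂ)) h2).mul_left 2)
  convert! h3 using 1
  · ext n
    have := sigmaOdd_add_sigma_half n.ne_zero
    rw [← @Nat.cast_inj ℂ] at this
    push_cast at this
    rw [← this]
    ring
  · rw [Pi.sub_apply, slash_diagTwoOne_apply, E2_eq_qexp, E2_eq_qexp, qexp_diagTwoOne_smul]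
    norm_num
    ring

lemma hasSum_Einf4 (z : ℍ) :
    HasSum (fun n : ℕ+ ↦ (sigmaStar3 n : ℂ) * qexp z ^ (n : ℕ))
      ((E₄ z - (⇑E₄ ∣[(4 : ℤ)] diagTwoOne) z / 8) / 240) := by
  have h1 := hasSum_sigma 3 z
  have h2 := hasSum_sigma 3 (diagTwoOne • z)
  simp_rw [qexp_diagTwoOne_smul] at h2
  have h3 := h1.sub (hasSum_pow_of_hasSum_sq_pow
    (a := fun n ↦ (ArithmeticFunction.sigma 3 n : ℂ)) h2)
  convert! h3 using 1
  · ext n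
    have := sigmaStar3_add_sigma_half n.ne_zero
    rw [← @Nat.cast_inj ℂ] at this
    push_cast at this
    rw [← this]
    ring
  · rw [slash_diagTwoOne_apply, E₄_eq_qexp, E₄_eq_qexp, qexp_diagTwoOne_smul]
    norm_num
    ring

lemma Egamma2_eq : (fun z : ℍ ↦ Egamma2 z) = (E2 ∣[(2 : ℤ)] diagTwoOne) - E2 := by
  ext z
  rw [Egamma2, (hasSum_Egamma2 z).tsum_eq]
  ring

lemma Einf4_eq :
    (fun z : ℍ ↦ Einf4 z) = (240⁻¹ : ℂ) • (⇑E₄ - (8⁻¹ : ℂ) • (⇑E₄ ∣[(4 : ℤ)] diagTwoOne)) := by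
  ext z
  rw [Einf4, (hasSum_Einf4 z).tsum_eq]
  simp
  ring

lemma isGamma0TwoForm_Einf4 : IsGamma0TwoForm 4 (fun z : ℍ ↦ Einf4 z) := by
  rw [Einf4_eq]
  exact ((isGamma0TwoForm_of_levelOne E₄).sub
    ((isGamma0TwoForm_slash_diagTwoOne E₄).smul _)).smul _

lemma D2_slash_diagTwoOne {γ δ : SL(2, ℤ)} (h10 : γ 1 0 = 2 * δ 1 0) (h11 : γ 1 1 = δ 1 1) :
    D2 δ ∣[(2 : ℤ)] diagTwoOne = D2 γ := by
  ext z
  rw [slash_diagTwoOne_apply, D2, D2]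
  simp [denom, coe_diagTwoOne_smul, h10, h11]
  ring_nf

lemma D2_S_slash_diagOneTwo : D2 ModularGroup.S ∣[(2 : ℤ)] diagOneTwo = D2 ModularGroup.S := by
  ext z
  rw [slash_diagOneTwo_apply, D2_S, D2_S, coe_diagOneTwo_smul]
  ring_nf

lemma isGamma0TwoForm_Egamma2 : IsGamma0TwoForm 2 (fun z : ℍ ↦ Egamma2 z) := by
  rw [Egamma2_eq]
  have hσ (g : GL (Fin 2) ℝ) (c : ℂ) (F G : ℍ → ℂ) (hg : 0 < g.det.val) :
      (F - c • G) ∣[(2 : ℤ)] g = F ∣[(2 : ℤ)] g - c • (G ∣[(2 : ℤ)] g) := by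
    rw [sub_eq_add_neg, SlashAction.add_slash, SlashAction.neg_slash, smul_slash, σ, if_pos hg]
    rfl
  have hsub (γ : SL(2, ℤ)) (F G : ℍ → ℂ) :
      (F - G) ∣[(2 : ℤ)] γ = F ∣[(2 : ℤ)] γ - G ∣[(2 : ℤ)] γ := by
    rw [sub_eq_add_neg, SlashAction.add_slash, SlashAction.neg_slash, sub_eq_add_neg]
  refine .mk ((E2_mdifferentiable.slash _ _).sub E2_mdifferentiable) (fun γ hγ ↦ ?_)
    ((isBoundedAtImInfty_E2.slash _ ?_).sub isBoundedAtImInfty_E2) ?_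
  · obtain ⟨δ, hδ, h10, h11⟩ := exists_diagTwoOne_mul hγ
    rw [hsub, SL_slash, ← SlashAction.slash_mul, hδ, SlashAction.slash_mul, ← SL_slash,
      E2_slash_action, E2_slash_action, hσ _ _ _ _ (by simp [diagTwoOne]),
      D2_slash_diagTwoOne h10 h11]
    abel
  · simp [diagTwoOne, Matrix.GeneralLinearGroup.mkOfDetNeZero]
  · rw [hsub, SL_slash, ← SlashAction.slash_mul, diagTwoOne_mul_S, SlashAction.slash_mul,
      ← SL_slash, E2_slash_action, hσ _ _ _ _ (by simp [diagOneTwo]), D2_S_slash_diagOneTwo,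
      sub_sub_sub_cancel_right]
    refine (isBoundedAtImInfty_E2.slash _ ?_).sub isBoundedAtImInfty_E2
    simp [diagOneTwo, Matrix.GeneralLinearGroup.mkOfDetNeZero]

lemma qexp_eq_qParam (z : ℂ) : qexp z = Function.Periodic.qParam 1 z := by
  rw [qexp, Function.Periodic.qParam, ofReal_one, div_one]

lemma tendsto_zero_of_hasSum_qexp {F : ℍ → ℂ} {a : ℕ → ℂ}
    (h : ∀ z : ℍ, HasSum (fun n : ℕ+ ↦ a n * qexp z ^ (n : ℕ)) (F z)) :
    Tendsto F atImInfty (𝓝 0) := by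
  have hq (z : ℍ) : qexp z ≠ 0 := Complex.exp_ne_zero _
  have hb : IsBoundedAtImInfty (fun z ↦ F z / qexp z) := by
    refine isBoundedAtImInfty_of_hasSum_qExpansion (c := fun n ↦ a (n + 1)) one_pos fun z ↦ ?_
    have := (Equiv.pnatEquivNat.symm.hasSum_iff.mpr (h z)).div_const (qexp z)
    convert! this using 2 with n
    rw [← qexp_eq_qParam]
    simp only [Function.comp_apply, Equiv.pnatEquivNat_symm_apply, Nat.succPNat_coe,
      Nat.succ_eq_add_one, smul_eq_mul]
    field_simp [hq z]
    ring
  have hq0 : Tendsto (fun z : ℍ ↦ qexp z) atImInfty (𝓝 0) := by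
    simp_rw [qexp_eq_qParam]
    exact qParam_tendsto_atImInfty one_pos
  have hO : F =O[atImInfty] fun z : ℍ ↦ ‖qexp z‖ :=
    (IsBigO.mul hb (isBigO_refl (fun z : ℍ ↦ qexp z) atImInfty).norm_right).congr
      (fun z ↦ div_mul_cancel₀ _ (hq z)) fun z ↦ one_mul _
  exact hO.trans_tendsto (by simpa using hq0.norm)

lemma tendsto_E₄ : Tendsto E₄ atImInfty (𝓝 1) := by
  have := (tendsto_zero_of_hasSum_qexp
    (a := fun n ↦ (ArithmeticFunction.sigma 3 n : ℂ)) (hasSum_sigma 3)).const_mul 240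
  simpa [← E₄_eq_qexp] using this.const_add 1

lemma tendsto_Egamma2 : Tendsto (fun z : ℍ ↦ Egamma2 z) atImInfty (𝓝 1) := by
  have := (tendsto_zero_of_hasSum_qexp
    (a := fun n ↦ (sigmaOdd n : ℂ)) fun z ↦ (hasSum_Egamma2 z).summable.hasSum).const_mul 24
  simpa [Egamma2] using this.const_add 1

lemma tendsto_Einf4 : Tendsto (fun z : ℍ ↦ Einf4 z) atImInfty (𝓝 0) :=
  tendsto_zero_of_hasSum_qexp (a := fun n ↦ (sigmaStar3 n : ℂ))
    fun z ↦ (hasSum_Einf4 z).summable.hasSum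

lemma tendsto_diagOneTwo_smul : Tendsto (diagOneTwo • · : ℍ → ℍ) atImInfty atImInfty :=
  tendsto_smul_atImInfty (by simp [diagOneTwo, Matrix.GeneralLinearGroup.mkOfDetNeZero])

lemma tendsto_Einf4_slash_S :
    Tendsto ((fun z : ℍ ↦ Einf4 z) ∣[(4 : ℤ)] ModularGroup.S) atImInfty (𝓝 256⁻¹) := by
  have hinv : ⇑E₄ ∣[(4 : ℤ)] ModularGroup.S = E₄ := E₄.slash_action_eq' _ ⟨_, rfl⟩
  have : (fun z : ℍ ↦ Einf4 z) ∣[(4 : ℤ)] ModularGroup.S =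
      fun z ↦ 240⁻¹ * (E₄ z - 8⁻¹ * (2⁻¹ * E₄ (diagOneTwo • z))) := by
    ext z
    rw [Einf4_eq, ModularForm.SL_smul_slash, sub_eq_add_neg, SlashAction.add_slash,
      SlashAction.neg_slash, ModularForm.SL_smul_slash, hinv]
    rw [SL_slash, ← SlashAction.slash_mul, diagTwoOne_mul_S, SlashAction.slash_mul, ← SL_slash,
      hinv]
    simp only [Pi.smul_apply, Pi.add_apply, Pi.neg_apply, slash_diagOneTwo_apply, smul_eq_mul,
      sub_eq_add_neg]
  rw [this]
  have := (tendsto_E₄.sub (((tendsto_E₄.comp tendsto_diagOneTwo_smul).const_mul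
    2⁻¹).const_mul 8⁻¹)).const_mul 240⁻¹
  convert! this using 2
  norm_num

lemma IsGamma0TwoForm.exp_decay_sub {k : ℤ} {F : ℍ → ℂ} (hF : IsGamma0TwoForm k F) :
    (fun z ↦ F z - valueAtInfty F) =O[atImInfty] fun z ↦ Real.exp (-2 * Real.pi * z.im) := by
  have hol := hF.mdifferentiable
  have hb := hF.isBoundedAtImInfty
  obtain ⟨f, rfl⟩ := hF
  simpa using exp_decay_sub_atImInfty one_pos
    (SlashInvariantFormClass.periodic_comp_ofComplex f (h := 1) (by simp)) hol hb

lemma discriminant_slash_diagTwoOne_ne_zero (z : ℍ) :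
    (discriminant ∣[(12 : ℤ)] diagTwoOne) z ≠ 0 := by
  rw [slash_diagTwoOne_apply]
  exact mul_ne_zero (zpow_ne_zero _ two_ne_zero) (discriminant_ne_zero _)

lemma isGamma0TwoForm_discriminant_slash_diagTwoOne :
    IsGamma0TwoForm 12 (discriminant ∣[(12 : ℤ)] diagTwoOne) :=
  isGamma0TwoForm_slash_diagTwoOne (CuspForm.discriminant : CuspForm 𝒮ℒ 12).toModularFormₗ

lemma exp_isBigO_discriminant_slash_diagTwoOne :
    (fun z : ℍ ↦ Real.exp (-2 * Real.pi * z.im) ^ 2) =O[atImInfty]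
      (discriminant ∣[(12 : ℤ)] diagTwoOne) := by
  have h := exp_isBigO_discriminant.comp_tendsto (tendsto_smul_atImInfty (g := diagTwoOne)
    (by simp [diagTwoOne, Matrix.GeneralLinearGroup.mkOfDetNeZero]))
  have := h.const_mul_right (c := (2 : ℂ) ^ ((12 : ℤ) - 1)) (zpow_ne_zero _ two_ne_zero)
  refine this.congr (fun z ↦ ?_) fun z ↦ (slash_diagTwoOne_apply _ _ z).symm
  rw [Function.comp_apply, ← coe_im, coe_diagTwoOne_smul, ← Real.exp_nat_mul]
  simp
  ring

lemma exp_isBigO_discriminant_slash_diagOneTwo :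
    (fun z : ℍ ↦ Real.exp (-2 * Real.pi * z.im)) =O[atImInfty]
      (discriminant ∣[(12 : ℤ)] diagOneTwo * discriminant ∣[(12 : ℤ)] diagOneTwo) := by
  have h := exp_isBigO_discriminant.comp_tendsto tendsto_diagOneTwo_smul
  have := h.const_mul_right (c := (2 : ℂ)⁻¹) (by simp)
  refine (this.mul this).congr (fun z ↦ ?_) fun z ↦ by
    simp [Pi.mul_apply, slash_diagOneTwo_apply]
  rw [Function.comp_apply, ← coe_im, coe_diagOneTwo_smul, ← Real.exp_add]
  simp
  ring

lemma discriminant_isBigO_exp :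
    discriminant =O[atImInfty] fun z ↦ Real.exp (-2 * Real.pi * z.im) := by
  simpa using CuspFormClass.exp_decay_atImInfty (h := 1) CuspForm.discriminant one_pos
    one_mem_strictPeriods_SL

lemma Einf4_isBigO_exp :
    (fun z : ℍ ↦ Einf4 z) =O[atImInfty] fun z ↦ Real.exp (-2 * Real.pi * z.im) := by
  have := isGamma0TwoForm_Einf4.exp_decay_sub
  rw [IsZeroAtImInfty.valueAtInfty_eq_zero tendsto_Einf4] at this
  simpa using this

lemma exists_Einf4_pow_three_mul_discriminant :
    ∃ c : ℂ, c ≠ 0 ∧ ∀ z : ℍ, Einf4 z ^ 3 * discriminant z =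
      c * (discriminant ∣[(12 : ℤ)] diagTwoOne) z ^ 2 := by
  set E : ℍ → ℂ := fun z ↦ Einf4 z with hE
  set D : ℍ → ℂ := discriminant ∣[(12 : ℤ)] diagTwoOne with hD
  have hEf : IsGamma0TwoForm 4 E := isGamma0TwoForm_Einf4
  have hDf : IsGamma0TwoForm 12 D := isGamma0TwoForm_discriminant_slash_diagTwoOne
  have hΔf : IsGamma0TwoForm 12 discriminant :=
    isGamma0TwoForm_of_levelOne (CuspForm.discriminant : CuspForm 𝒮ℒ 12).toModularFormₗ
  have hD0 (z : ℍ) : D z ≠ 0 := discriminant_slash_diagTwoOne_ne_zero z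
  have hΔS : discriminant ∣[(12 : ℤ)] ModularGroup.S = discriminant := discriminant_S_invariant
  have hDS : D ∣[(12 : ℤ)] ModularGroup.S = discriminant ∣[(12 : ℤ)] diagOneTwo := by
    rw [hD, SL_slash, ← SlashAction.slash_mul, diagTwoOne_mul_S, SlashAction.slash_mul,
      ← SL_slash, hΔS]
  have hquot : IsGamma0TwoForm 0 ((E * E * E * discriminant) / (D * D)) := by
    refine (((hEf.mul hEf).mul hEf).mul hΔf).div (hDf.mul hDf) (fun z ↦ by simp [hD0]) ?_ ?_
    · have he := Einf4_isBigO_exp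
      refine ((((he.mul he).mul he).mul discriminant_isBigO_exp).congr_right fun z ↦ ?_).trans
        (exp_isBigO_discriminant_slash_diagTwoOne.mul exp_isBigO_discriminant_slash_diagTwoOne)
      ring
    · rw [mul_slash_SL2, mul_slash_SL2, mul_slash_SL2, mul_slash_SL2, hΔS, hDS]
      have hb := hEf.isBoundedAtImInfty_slash ModularGroup.S
      refine ((IsBigO.mul (IsBigO.mul (IsBigO.mul hb hb) hb)
        discriminant_isBigO_exp).congr_right fun z ↦ ?_).trans
        exp_isBigO_discriminant_slash_diagOneTwo
      simp
  obtain ⟨f, hf⟩ := hquot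
  obtain ⟨c, hc⟩ := ModularForm.eq_const_of_weight_zero f
  have key (z : ℍ) : Einf4 z ^ 3 * discriminant z =
      c * D z ^ 2 := by
    have := congrFun (hf.symm.trans hc) z
    simp only [Pi.div_apply, Pi.mul_apply, Function.const_apply] at this
    rw [div_eq_iff (mul_ne_zero (hD0 z) (hD0 z))] at this
    rw [← sub_eq_zero] at this ⊢
    rw [← this]
    ring
  refine ⟨c, ?_, key⟩
  rintro rfl
  have hE0 : E = 0 := by
    ext z
    simpa [discriminant_ne_zero] using key z
  have := tendsto_Einf4_slash_S
  rw [← hE, hE0, SlashAction.zero_slash] at this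
  exact inv_ne_zero (OfNat.ofNat_ne_zero 256)
    (tendsto_nhds_unique this (tendsto_const_nhds (x := (0 : ℂ))))

lemma Einf4_ne_zero (z : ℍ) : Einf4 z ≠ 0 := by
  obtain ⟨c, hc, h⟩ := exists_Einf4_pow_three_mul_discriminant
  intro h0
  have := h z
  rw [h0, zero_pow three_ne_zero, zero_mul] at this
  exact mul_ne_zero hc (pow_ne_zero 2 (discriminant_slash_diagTwoOne_ne_zero z)) this.symm

lemma exp_isBigO_Einf4 :
    (fun z : ℍ ↦ Real.exp (-2 * Real.pi * z.im)) =O[atImInfty] fun z : ℍ ↦ Einf4 z := by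
  obtain ⟨c, hc, h⟩ := exists_Einf4_pow_three_mul_discriminant
  have h1 := exp_isBigO_discriminant_slash_diagTwoOne.pow 2
  have h2 := (h1.const_mul_right hc).congr_right fun z ↦ (h z).symm
  have h3 := h2.trans ((isBigO_refl (fun z : ℍ ↦ Einf4 z ^ 3) atImInfty).norm_right.mul
    discriminant_isBigO_exp)
  refine IsBigO.of_pow three_ne_zero ?_
  refine .of_norm_right ((h3.mul (isBigO_refl
    (fun z : ℍ ↦ (Real.exp (-2 * Real.pi * z.im))⁻¹) atImInfty)).congr (fun z ↦ ?_) fun z ↦ ?_)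
  · simp only [Pi.pow_apply]
    field_simp
  · simp only [Pi.pow_apply]
    field_simp

lemma one_isBigO_Einf4_slash_S : (1 : ℍ → ℝ) =O[atImInfty]
    ((fun z : ℍ ↦ Einf4 z) ∣[(4 : ℤ)] ModularGroup.S) := by
  have h : (256⁻¹ : ℂ) ≠ 0 := inv_ne_zero (OfNat.ofNat_ne_zero 256)
  exact (isBigO_const_const 1 h _).trans
    ((isEquivalent_const_iff_tendsto h).mpr tendsto_Einf4_slash_S).isBigO_symm

/-- Subtracting a power of `E_{γ,2}` and dividing by `E_{∞,4}` lowers the weight by `4`. -/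
lemma IsGamma0TwoForm.exists_eq_add_mul {k : ℤ} {n : ℕ} (hk : k = n * 2) {F : ℍ → ℂ}
    (hF : IsGamma0TwoForm k F) :
    ∃ (c : ℂ) (G : ℍ → ℂ), IsGamma0TwoForm (k - 4) G ∧
      ∀ z : ℍ, F z = c * Egamma2 z ^ n + Einf4 z * G z := by
  set P : ℍ → ℂ := (fun z : ℍ ↦ Egamma2 z) ^ n with hP
  subst hk
  have hH : IsGamma0TwoForm (n * 2) (F - valueAtInfty F • P) :=
    hF.sub ((isGamma0TwoForm_Egamma2.pow n).smul _)
  have htend : Tendsto F atImInfty (𝓝 (valueAtInfty F)) := by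
    rw [← tendsto_sub_nhds_zero_iff]
    refine hF.exp_decay_sub.trans_tendsto ?_
    refine (Real.tendsto_exp_atBot.comp (tendsto_comap.const_mul_atTop_of_neg ?_))
    linarith [Real.pi_pos]
  have hzero : IsZeroAtImInfty (F - valueAtInfty F • P) := by
    have := htend.sub ((tendsto_Egamma2.pow n).const_mul (valueAtInfty F))
    rwa [one_pow, mul_one, sub_self] at this
  have hO : (F - valueAtInfty F • P) =O[atImInfty] fun z : ℍ ↦ Einf4 z := by
    have := hH.exp_decay_sub
    rw [hzero.valueAtInfty_eq_zero] at this
    exact (this.congr_left fun z ↦ sub_zero _).trans exp_isBigO_Einf4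
  refine ⟨valueAtInfty F, _, hH.div isGamma0TwoForm_Einf4 Einf4_ne_zero hO
    ((hH.isBoundedAtImInfty_slash _).trans one_isBigO_Einf4_slash_S), fun z ↦ ?_⟩
  simp only [Pi.div_apply, Pi.sub_apply, Pi.smul_apply, hP, Pi.pow_apply, smul_eq_mul]
  rw [mul_div_cancel₀ _ (Einf4_ne_zero z)]
  ring

lemma IsGamma0TwoForm.eq_zero_of_neg {k : ℤ} (hk : k < 0) {F : ℍ → ℂ} (hF : IsGamma0TwoForm k F) :
    F = 0 := by
  obtain ⟨f, rfl⟩ := hF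
  rw [ModularForm.isZero_of_neg_weight hk f]
  rfl

lemma j2_mul_Einf4 (z : ℍ) : j2 z * Einf4 z = Egamma2 z ^ 2 :=
  div_mul_cancel₀ _ (Einf4_ne_zero z)

/-- Every form of weight `4 m + 2 e` with `e ∈ {0, 1}` is `E_{γ,2} ^ e * p(j₂) * E_{∞,4} ^ m`
for a polynomial `p` of degree at most `m`. -/
lemma IsGamma0TwoForm.exists_polynomial {k : ℤ} {e m : ℕ} (he : e < 2)
    (hk : k = 4 * m + 2 * e) {F : ℍ → ℂ} (hF : IsGamma0TwoForm k F) :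
    ∃ p : Polynomial ℂ, p.natDegree ≤ m ∧
      ∀ z : ℍ, F z = Egamma2 z ^ e * p.eval (j2 z) * Einf4 z ^ m := by
  induction m generalizing k F with
  | zero =>
    obtain ⟨c, G, hG, h⟩ := hF.exists_eq_add_mul (n := e) (by rw [hk]; push_cast; ring)
    have hG0 : G = 0 := hG.eq_zero_of_neg (by omega)
    refine ⟨Polynomial.C c, by simp, fun z ↦ ?_⟩
    rw [h, hG0]
    simp [mul_comm]
  | succ m ih =>
    obtain ⟨c, G, hG, h⟩ := hF.exists_eq_add_mul (n := 2 * (m + 1) + e)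
      (by rw [hk]; push_cast; ring)
    obtain ⟨p, hp, hpG⟩ := ih (by rw [hk]; push_cast; ring) hG
    refine ⟨Polynomial.C c * Polynomial.X ^ (m + 1) + p, ?_, fun z ↦ ?_⟩
    · exact Polynomial.natDegree_add_le_of_degree_le (Polynomial.natDegree_C_mul_X_pow_le _ _)
        (by omega)
    · rw [h, hpG]
      simp only [Polynomial.eval_add, Polynomial.eval_mul, Polynomial.eval_C, Polynomial.eval_pow,
        Polynomial.eval_X]
      rw [pow_add, pow_mul, ← j2_mul_Einf4]
      ring

lemma isGamma0TwoForm_polynomial {k : ℤ} {e m : ℕ} (hk : k = 4 * m + 2 * e)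
    {p : Polynomial ℂ} (hp : p.natDegree ≤ m) :
    IsGamma0TwoForm k (fun z : ℍ ↦ Egamma2 z ^ e * p.eval (j2 z) * Einf4 z ^ m) := by
  refine Polynomial.induction_with_natDegree_le (fun p ↦ IsGamma0TwoForm k
    (fun z : ℍ ↦ Egamma2 z ^ e * p.eval (j2 z) * Einf4 z ^ m)) m ?_ (fun n r _ hn ↦ ?_)
    (fun p q _ _ hp hq ↦ ?_) p hp
  · convert! (isGamma0TwoForm_Egamma2.pow (2 * m + e)).smul 0 using 1
    · rw [hk]
      push_cast
      ring
    · ext z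
      simp
  · have := ((isGamma0TwoForm_Egamma2.pow (2 * n + e)).mul
      (isGamma0TwoForm_Einf4.pow (m - n))).smul r
    convert! this using 1
    · rw [hk]
      push_cast [hn]
      ring
    · ext z
      simp only [Polynomial.eval_mul, Polynomial.eval_C, Polynomial.eval_pow,
        Polynomial.eval_X, Pi.smul_apply, Pi.mul_apply, Pi.pow_apply, smul_eq_mul]
      rw [pow_add, pow_mul, ← j2_mul_Einf4, mul_pow, ← pow_sub_mul_pow _ hn]
      ring
  · convert! hp.add hq using 1
    ext z
    simp only [Polynomial.eval_add, Pi.add_apply]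
    ring

lemma infinite_range_j2 : (Set.range fun z : ℍ ↦ j2 z).Infinite := by
  intro hfin
  have hb : (fun z : ℍ ↦ j2 z) =O[atImInfty] (1 : ℍ → ℝ) := by
    obtain ⟨C, hC⟩ := hfin.isBounded.exists_norm_le
    exact .of_bound C (.of_forall fun z ↦ by simpa using hC _ ⟨z, rfl⟩)
  have h1 : Tendsto (fun z : ℍ ↦ j2 z * Einf4 z) atImInfty (𝓝 0) := by
    simpa using (hb.mul (isBigO_refl (fun z : ℍ ↦ Einf4 z) atImInfty).norm_right).trans_tendsto
      (by simpa using tendsto_Einf4.norm)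
  simp_rw [j2_mul_Einf4] at h1
  simpa using tendsto_nhds_unique h1 (tendsto_Egamma2.pow 2)

lemma polynomial_eq_of_eval_j2 {p q : Polynomial ℂ}
    (h : ∀ z : ℍ, p.eval (j2 z) = q.eval (j2 z)) : p = q :=
  Polynomial.eq_of_infinite_eval_eq p q <| infinite_range_j2.mono <| by
    rintro _ ⟨z, rfl⟩
    exact h z

lemma polynomial_eq_of_forall_mul {p q : Polynomial ℂ} {m : ℕ}
    (h : ∀ z : ℍ, p.eval (j2 z) * Einf4 z ^ m = q.eval (j2 z) * Einf4 z ^ m) : p = q :=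
  polynomial_eq_of_eval_j2 fun z ↦ mul_right_cancel₀ (pow_ne_zero m (Einf4_ne_zero z)) (h z)

lemma IsGamma0TwoForm.eq_of_mul_Egamma2 {k : ℤ} {F G : ℍ → ℂ} (hF : IsGamma0TwoForm k F)
    (hG : IsGamma0TwoForm k G) (h : ∀ z : ℍ, F z * Egamma2 z = G z * Egamma2 z) : F = G := by
  have h0 : (F - G) * (fun z : ℍ ↦ Egamma2 z) = 0 := by
    ext z
    simp [sub_mul, h]
  rcases (UpperHalfPlane.mul_eq_zero_iff (hF.sub hG).mdifferentiable
    isGamma0TwoForm_Egamma2.mdifferentiable).mp h0 with h1 | h1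
  · exact sub_eq_zero.mp h1
  · have := tendsto_Egamma2
    rw [h1] at this
    exact absurd (tendsto_nhds_unique this (tendsto_const_nhds (x := (0 : ℂ)))) one_ne_zero

/-- Proposition 2.8: with `r = ⌊h/4⌋ + 1`, the map `W₂` (given by
`f ↦ f·E_{∞,4}^{−h/4}` if `h ≡ 0 (mod 4)` and `f ↦ f·E_{γ,2}·E_{∞,4}^{−(h+2)/4}` if
`h ≡ 2 (mod 4)`) is a vector space isomorphism of `M(2,h)` onto the polynomials in `j₂`
of degree `≤ r−1`, respectively onto those with zero constant term and degree `≤ r`.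
(Multiplying through by the relevant power of `E_{∞,4}` expresses this without division:
`W₂(f) = p(j₂)` iff `f = p(j₂)·E_{∞,4}^{h/4}`, resp.
`f·E_{γ,2} = p(j₂)·E_{∞,4}^{(h+2)/4}`.) -/
theorem stmt12 (h : ℕ) (hpos : 0 < h) (heven : Even h) :
    (h % 4 = 0 →
      (∀ f : ModularForm (CongruenceSubgroup.Gamma0 2) (h : ℤ),
        ∃! p : Polynomial ℂ, p.natDegree ≤ h / 4 ∧
          ∀ z : ℍ, f z = p.eval (j2 (z : ℂ)) * Einf4 (z : ℂ) ^ (h / 4)) ∧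
      (∀ p : Polynomial ℂ, p.natDegree ≤ h / 4 →
        ∃! f : ModularForm (CongruenceSubgroup.Gamma0 2) (h : ℤ),
          ∀ z : ℍ, f z = p.eval (j2 (z : ℂ)) * Einf4 (z : ℂ) ^ (h / 4))) ∧
    (h % 4 = 2 →
      (∀ f : ModularForm (CongruenceSubgroup.Gamma0 2) (h : ℤ),
        ∃! p : Polynomial ℂ, p.coeff 0 = 0 ∧ p.natDegree ≤ h / 4 + 1 ∧
          ∀ z : ℍ, f z * Egamma2 (z : ℂ) =
            p.eval (j2 (z : ℂ)) * Einf4 (z : ℂ) ^ (h / 4 + 1)) ∧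
      (∀ p : Polynomial ℂ, p.coeff 0 = 0 → p.natDegree ≤ h / 4 + 1 →
        ∃! f : ModularForm (CongruenceSubgroup.Gamma0 2) (h : ℤ),
          ∀ z : ℍ, f z * Egamma2 (z : ℂ) =
            p.eval (j2 (z : ℂ)) * Einf4 (z : ℂ) ^ (h / 4 + 1))) := by
  have hmul (p : Polynomial ℂ) (m : ℕ) (z : ℍ) :
      Egamma2 z ^ 1 * p.eval (j2 z) * Einf4 z ^ m * Egamma2 z =
        (Polynomial.X * p).eval (j2 z) * Einf4 z ^ (m + 1) := by
    rw [Polynomial.eval_mul, Polynomial.eval_X, pow_succ]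
    linear_combination -(p.eval (j2 z) * Einf4 z ^ m) * j2_mul_Einf4 z
  refine ⟨fun h4 ↦ ?_, fun h4 ↦ ?_⟩
  · have hk : (h : ℤ) = 4 * (h / 4 : ℕ) + 2 * (0 : ℕ) := by omega
    refine ⟨fun f ↦ ?_, fun p hp ↦ ?_⟩
    · obtain ⟨p, hp, hf⟩ := IsGamma0TwoForm.exists_polynomial two_pos hk ⟨f, rfl⟩
      simp only [pow_zero, one_mul] at hf
      exact ⟨p, ⟨hp, hf⟩, fun q hq ↦
        polynomial_eq_of_forall_mul fun z ↦ (hq.2 z).symm.trans (hf z)⟩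
    · obtain ⟨f, hf⟩ := isGamma0TwoForm_polynomial hk hp
      refine ⟨f, fun z ↦ by simp [hf], fun g hg ↦ ?_⟩
      ext z
      simp [hg z, hf]
  · have hk : (h : ℤ) = 4 * (h / 4 : ℕ) + 2 * (1 : ℕ) := by omega
    refine ⟨fun f ↦ ?_, fun p hp0 hp ↦ ?_⟩
    · obtain ⟨p, hp, hf⟩ := IsGamma0TwoForm.exists_polynomial one_lt_two hk ⟨f, rfl⟩
      refine ⟨Polynomial.X * p, ⟨by simp, ?_, fun z ↦ by rw [hf, hmul]⟩, fun q hq ↦ ?_⟩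
      · refine Polynomial.natDegree_mul_le.trans ?_
        rw [Polynomial.natDegree_X]
        omega
      · refine polynomial_eq_of_forall_mul fun z ↦ (hq.2.2 z).symm.trans ?_
        rw [hf, hmul]
    · obtain ⟨p, rfl⟩ := Polynomial.X_dvd_iff.mpr hp0
      have hp' : p.natDegree ≤ h / 4 := by
        by_cases hz : p = 0
        · simp [hz]
        · rw [Polynomial.natDegree_X_mul hz] at hp
          omega
      obtain ⟨f, hf⟩ := isGamma0TwoForm_polynomial hk hp'
      have hfz (z : ℍ) := (congrArg (· * Egamma2 z) (congrFun hf z)).trans (hmul p _ z)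
      refine ⟨f, hfz, fun g hg ↦ ?_⟩
      exact DFunLike.coe_injective <| IsGamma0TwoForm.eq_of_mul_Egamma2 ⟨g, rfl⟩ ⟨f, rfl⟩
        fun z ↦ (hg z).trans (hfz z).symm

end
end
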